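/- There are no natural numbers n, k with 2 ≤ k ≤ n/2 and 2 ≤ k+1 ≤ (n-2)/2 such that C(n, k) = C(n-2, k+1), where C denotes the binomial coefficient. -/

import Mathlib

/-- The ring `R[q]` with `q ^ 3 = 5 * q ^ 2 - 8 * q + 3`, in coordinates with respect to
`1, q, q ^ 2`. -/
@[ext]
structure CubicRing (R : Type*) where
  c0 : R
  c1 : R
  c2 : R
deriving DecidableEq

namespace CubicRing

variable {R : Type*} [CommRing R]

instance : Zero (CubicRing R) := ⟨⟨0, 0, 0⟩⟩
instance : One (CubicRing R) := ⟨⟨1, 0, 0⟩⟩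
instance : Add (CubicRing R) := ⟨fun x y => ⟨x.c0 + y.c0, x.c1 + y.c1, x.c2 + y.c2⟩⟩
instance : Neg (CubicRing R) := ⟨fun x => ⟨-x.c0, -x.c1, -x.c2⟩⟩
instance : Mul (CubicRing R) := ⟨fun x y =>
  ⟨x.c0 * y.c0 + 3 * (x.c1 * y.c2 + x.c2 * y.c1) + 15 * (x.c2 * y.c2),
   x.c0 * y.c1 + x.c1 * y.c0 - 8 * (x.c1 * y.c2 + x.c2 * y.c1) - 37 * (x.c2 * y.c2),
   x.c0 * y.c2 + x.c1 * y.c1 + x.c2 * y.c0 + 5 * (x.c1 * y.c2 + x.c2 * y.c1)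
    + 17 * (x.c2 * y.c2)⟩⟩

@[simp] lemma c0_zero : (0 : CubicRing R).c0 = 0 := rfl
@[simp] lemma c1_zero : (0 : CubicRing R).c1 = 0 := rfl
@[simp] lemma c2_zero : (0 : CubicRing R).c2 = 0 := rfl
@[simp] lemma c0_one : (1 : CubicRing R).c0 = 1 := rfl
@[simp] lemma c1_one : (1 : CubicRing R).c1 = 0 := rfl
@[simp] lemma c2_one : (1 : CubicRing R).c2 = 0 := rfl
@[simp] lemma c0_add (x y : CubicRing R) : (x + y).c0 = x.c0 + y.c0 := rfl
@[simp] lemma c1_add (x y : CubicRing R) : (x + y).c1 = x.c1 + y.c1 := rfl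
@[simp] lemma c2_add (x y : CubicRing R) : (x + y).c2 = x.c2 + y.c2 := rfl
@[simp] lemma c0_neg (x : CubicRing R) : (-x).c0 = -x.c0 := rfl
@[simp] lemma c1_neg (x : CubicRing R) : (-x).c1 = -x.c1 := rfl
@[simp] lemma c2_neg (x : CubicRing R) : (-x).c2 = -x.c2 := rfl
@[simp] lemma c0_mul (x y : CubicRing R) : (x * y).c0 =
    x.c0 * y.c0 + 3 * (x.c1 * y.c2 + x.c2 * y.c1) + 15 * (x.c2 * y.c2) := rfl
@[simp] lemma c1_mul (x y : CubicRing R) : (x * y).c1 =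
    x.c0 * y.c1 + x.c1 * y.c0 - 8 * (x.c1 * y.c2 + x.c2 * y.c1) - 37 * (x.c2 * y.c2) := rfl
@[simp] lemma c2_mul (x y : CubicRing R) : (x * y).c2 =
    x.c0 * y.c2 + x.c1 * y.c1 + x.c2 * y.c0 + 5 * (x.c1 * y.c2 + x.c2 * y.c1)
      + 17 * (x.c2 * y.c2) := rfl

instance : CommRing (CubicRing R) where
  add_assoc _ _ _ := by ext <;> simp <;> ring
  zero_add _ := by ext <;> simp
  add_zero _ := by ext <;> simp
  add_comm _ _ := by ext <;> simp <;> ring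
  mul_assoc _ _ _ := by ext <;> simp <;> ring
  one_mul _ := by ext <;> simp
  mul_one _ := by ext <;> simp
  mul_comm _ _ := by ext <;> simp <;> ring
  left_distrib _ _ _ := by ext <;> simp <;> ring
  right_distrib _ _ _ := by ext <;> simp <;> ring
  zero_mul _ := by ext <;> simp
  mul_zero _ := by ext <;> simp
  neg_add_cancel _ := by ext <;> simp
  nsmul := nsmulRec
  zsmul := zsmulRec

@[simp] lemma c0_sub (x y : CubicRing R) : (x - y).c0 = x.c0 - y.c0 := by
  simp [sub_eq_add_neg]
@[simp] lemma c1_sub (x y : CubicRing R) : (x - y).c1 = x.c1 - y.c1 := by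
  simp [sub_eq_add_neg]
@[simp] lemma c2_sub (x y : CubicRing R) : (x - y).c2 = x.c2 - y.c2 := by
  simp [sub_eq_add_neg]

/-- The inclusion of scalars. -/
def scalar : R →+* CubicRing R where
  toFun r := ⟨r, 0, 0⟩
  map_one' := rfl
  map_zero' := rfl
  map_mul' _ _ := by ext <;> simp
  map_add' _ _ := by ext <;> simp

lemma natCast_eq (n : ℕ) : (n : CubicRing R) = ⟨n, 0, 0⟩ := (map_natCast (scalar (R := R)) n).symm
lemma intCast_eq (n : ℤ) : (n : CubicRing R) = ⟨n, 0, 0⟩ := (map_intCast (scalar (R := R)) n).symm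
lemma ofNat_eq (n : ℕ) [n.AtLeastTwo] :
    (ofNat(n) : CubicRing R) = ⟨ofNat(n), 0, 0⟩ := (map_ofNat (scalar (R := R)) n).symm

@[simp] lemma c0_natCast (n : ℕ) : (n : CubicRing R).c0 = n := by rw [natCast_eq]
@[simp] lemma c1_natCast (n : ℕ) : (n : CubicRing R).c1 = 0 := by rw [natCast_eq]
@[simp] lemma c2_natCast (n : ℕ) : (n : CubicRing R).c2 = 0 := by rw [natCast_eq]
@[simp] lemma c0_intCast (n : ℤ) : (n : CubicRing R).c0 = n := by rw [intCast_eq]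
@[simp] lemma c1_intCast (n : ℤ) : (n : CubicRing R).c1 = 0 := by rw [intCast_eq]
@[simp] lemma c2_intCast (n : ℤ) : (n : CubicRing R).c2 = 0 := by rw [intCast_eq]
@[simp] lemma c0_ofNat (n : ℕ) [n.AtLeastTwo] : (ofNat(n) : CubicRing R).c0 = ofNat(n) := by
  rw [ofNat_eq]
@[simp] lemma c1_ofNat (n : ℕ) [n.AtLeastTwo] : (ofNat(n) : CubicRing R).c1 = 0 := by
  rw [ofNat_eq]
@[simp] lemma c2_ofNat (n : ℕ) [n.AtLeastTwo] : (ofNat(n) : CubicRing R).c2 = 0 := by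
  rw [ofNat_eq]

/-- Evaluation at a root of the defining cubic. -/
def eval {A : Type*} [CommRing A] [Algebra R A] (r : A) (hr : r ^ 3 = 5 * r ^ 2 - 8 * r + 3) :
    CubicRing R →+* A where
  toFun x := algebraMap R A x.c0 + algebraMap R A x.c1 * r + algebraMap R A x.c2 * r ^ 2
  map_one' := by simp
  map_zero' := by simp
  map_mul' x y := by
    simp only [c0_mul, c1_mul, c2_mul, map_add, map_sub, map_mul, map_ofNat]
    set a := algebraMap R A x.c0
    set b := algebraMap R A x.c1
    set c := algebraMap R A x.c2
    set d := algebraMap R A y.c0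
    set e := algebraMap R A y.c1
    set f := algebraMap R A y.c2
    linear_combination -(b * f + c * e + c * f * (r + 5)) * hr
  map_add' _ _ := by simp; ring

/-- Base change. -/
def map {R' : Type*} [CommRing R'] (f : R →+* R') : CubicRing R →+* CubicRing R' where
  toFun x := ⟨f x.c0, f x.c1, f x.c2⟩
  map_one' := by ext <;> simp
  map_zero' := by ext <;> simp
  map_mul' _ _ := by ext <;> simp [map_ofNat f]
  map_add' _ _ := by ext <;> simp

end CubicRing

namespace CubicRing

/-- The cubic has one real root and a pair of complex conjugate ones. -/
lemma exists_roots : ∃ (r : ℝ) (z : ℂ), (r : ℂ) ^ 3 = 5 * (r : ℂ) ^ 2 - 8 * (r : ℂ) + 3 ∧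
    z ^ 3 = 5 * z ^ 2 - 8 * z + 3 ∧ (r : ℂ) + z + starRingEnd ℂ z = 5 ∧
    (r : ℂ) ^ 2 + z ^ 2 + starRingEnd ℂ z ^ 2 = 9 := by
  obtain ⟨r, hr, h⟩ : ∃ r ∈ Set.Icc (0 : ℝ) 1, r ^ 3 - 5 * r ^ 2 + 8 * r - 3 = 0 := by
    have := intermediate_value_Icc (f := fun r : ℝ => r ^ 3 - 5 * r ^ 2 + 8 * r - 3)
      (zero_le_one' ℝ) (by fun_prop)
    exact this (by norm_num)
  set D : ℝ := 3 * r ^ 2 - 10 * r + 7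
  have hD : 0 ≤ D := by
    have := mul_nonneg (sub_nonneg.2 hr.2) (by linarith [hr.2] : (0 : ℝ) ≤ 7 - 3 * r)
    simp only [D]; linarith
  have hs : ((√D : ℝ) : ℂ) ^ 2 = D := by exact_mod_cast Real.sq_sqrt hD
  have hI := Complex.I_sq
  have hr' : (r : ℂ) ^ 3 - 5 * r ^ 2 + 8 * r - 3 = 0 := by exact_mod_cast h
  have hDc : (D : ℂ) = 3 * (r : ℂ) ^ 2 - 10 * r + 7 := by simp [D]
  rw [hDc] at hs
  have hc : starRingEnd ℂ ((5 - r + Complex.I * (√D : ℝ)) / 2) =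
      (5 - r - Complex.I * (√D : ℝ)) / 2 := by
    have h5 : starRingEnd ℂ 5 = 5 := map_ofNat _ 5
    have h2 : starRingEnd ℂ 2 = 2 := map_ofNat _ 2
    simp [sub_eq_add_neg, h5, h2]
  have hq : ((5 - r + Complex.I * (√D : ℝ)) / 2 : ℂ) ^ 2 =
      (5 - r) * ((5 - r + Complex.I * (√D : ℝ)) / 2) - (r ^ 2 - 5 * r + 8) := by
    linear_combination (√D : ℂ) ^ 2 / 4 * hI - 1 / 4 * hs
  refine ⟨r, (5 - r + Complex.I * (√D : ℝ)) / 2, by linear_combination hr', ?_, ?_, ?_⟩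
  · linear_combination (((5 - r + Complex.I * (√D : ℝ)) / 2 : ℂ) - r) * hq + hr'
  · rw [hc]; ring
  · rw [hc]
    linear_combination (√D : ℂ) ^ 2 / 2 * hI - 1 / 2 * hs

lemma eval_conj (z : ℂ) (hz : z ^ 3 = 5 * z ^ 2 - 8 * z + 3) (x : CubicRing ℤ) :
    starRingEnd ℂ (eval z hz x) =
      x.c0 + x.c1 * starRingEnd ℂ z + x.c2 * starRingEnd ℂ z ^ 2 := by
  simp [eval]

/-- Elements bounded at all archimedean places are finite in number. -/
lemma finite_bounded {r : ℝ} {z : ℂ} (hr : (r : ℂ) ^ 3 = 5 * (r : ℂ) ^ 2 - 8 * (r : ℂ) + 3)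
    (hz : z ^ 3 = 5 * z ^ 2 - 8 * z + 3) (h1 : (r : ℂ) + z + starRingEnd ℂ z = 5)
    (h2 : (r : ℂ) ^ 2 + z ^ 2 + starRingEnd ℂ z ^ 2 = 9) (K : ℝ) :
    {x : CubicRing ℤ | ‖eval (r : ℂ) hr x‖ ≤ K ∧ ‖eval z hz x‖ ≤ K}.Finite := by
  have key : ∀ x : CubicRing ℤ, ‖((3 * x.c0 + 5 * x.c1 + 9 * x.c2 : ℤ) : ℂ)‖ ≤
      ‖eval (r : ℂ) hr x‖ + 2 * ‖eval z hz x‖ := by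
    intro x
    have : ((3 * x.c0 + 5 * x.c1 + 9 * x.c2 : ℤ) : ℂ) =
        eval (r : ℂ) hr x + eval z hz x + starRingEnd ℂ (eval z hz x) := by
      rw [eval_conj]
      simp only [eval, algebraMap_int_eq, eq_intCast, RingHom.coe_mk, MonoidHom.coe_mk,
        OneHom.coe_mk, Int.cast_add, Int.cast_mul, Int.cast_ofNat]
      linear_combination -(x.c1 : ℂ) * h1 - (x.c2 : ℂ) * h2
    rw [this]
    refine (norm_add₃_le).trans (le_of_eq ?_)
    rw [RCLike.norm_conj]; ring
  have bound : ∀ b : CubicRing ℤ, ∃ N : ℤ, ∀ x : CubicRing ℤ,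
      ‖eval (r : ℂ) hr x‖ ≤ K → ‖eval z hz x‖ ≤ K →
      |3 * (b * x).c0 + 5 * (b * x).c1 + 9 * (b * x).c2| ≤ N := by
    intro b
    refine ⟨⌈‖eval (r : ℂ) hr b‖ * K + 2 * (‖eval z hz b‖ * K)⌉, fun x hx hx' => ?_⟩
    have := key (b * x)
    rw [map_mul, map_mul, norm_mul, norm_mul, Complex.norm_intCast] at this
    have h3 : ((|3 * (b * x).c0 + 5 * (b * x).c1 + 9 * (b * x).c2| : ℤ) : ℝ) ≤
        ‖eval (r : ℂ) hr b‖ * K + 2 * (‖eval z hz b‖ * K) := by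
      rw [Int.cast_abs]
      refine this.trans ?_
      gcongr
    exact_mod_cast h3.trans (Int.le_ceil _)
  obtain ⟨N0, hN0⟩ := bound ⟨79, -61, 11⟩
  obtain ⟨N1, hN1⟩ := bound ⟨-61, 42, -3⟩
  obtain ⟨N2, hN2⟩ := bound ⟨11, -3, -2⟩
  refine Set.Finite.subset (Set.Finite.image (fun p : ℤ × ℤ × ℤ => (⟨p.1, p.2.1, p.2.2⟩ :
    CubicRing ℤ)) ((Set.finite_Icc (-N0) N0).prod
      ((Set.finite_Icc (-N1) N1).prod (Set.finite_Icc (-N2) N2)))) ?_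
  rintro x ⟨hx, hx'⟩
  refine ⟨(x.c0, x.c1, x.c2), ?_, rfl⟩
  have e0 := hN0 x hx hx'
  have e1 := hN1 x hx hx'
  have e2 := hN2 x hx hx'
  simp only [c0_mul, c1_mul, c2_mul] at e0 e1 e2
  ring_nf at e0 e1 e2
  rw [abs_le] at e0 e1 e2
  simp only [Set.mem_prod, Set.mem_Icc]
  refine ⟨⟨?_, ?_⟩, ⟨?_, ?_⟩, ?_, ?_⟩ <;> omega

end CubicRing

open CubicRing

/-- The quadratic extension of `R[q]` by a square root of `δ`. -/
abbrev SqrtRing {R : Type*} [CommRing R] (δ : CubicRing R) := QuadraticAlgebra (CubicRing R) δ 0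

namespace SqrtRing

/-- The ring homomorphism to `ℂ` attached to a root of the cubic and a square root of `δ`. -/
def toComplex {δ : CubicRing ℤ} {r s : ℂ} (hr : r ^ 3 = 5 * r ^ 2 - 8 * r + 3)
    (hs : s * s = eval r hr δ) : SqrtRing δ →+* ℂ where
  toFun z := eval r hr z.re + s * eval r hr z.im
  map_one' := by
    rw [QuadraticAlgebra.re_one, QuadraticAlgebra.im_one, map_one, map_zero, mul_zero, add_zero]
  map_zero' := by
    rw [QuadraticAlgebra.re_zero, QuadraticAlgebra.im_zero, map_zero, mul_zero, add_zero]
  map_mul' x y := by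
    simp only [QuadraticAlgebra.re_mul, QuadraticAlgebra.im_mul, map_add, map_mul, ← hs, map_zero]
    ring
  map_add' _ _ := by simp; ring

lemma toComplex_mul_toComplex_neg {δ : CubicRing ℤ} {r s : ℂ}
    (hr : r ^ 3 = 5 * r ^ 2 - 8 * r + 3) (hs : s * s = eval r hr δ) {z : SqrtRing δ}
    (hz : QuadraticAlgebra.norm z = 1) :
    toComplex hr hs z * toComplex hr (s := -s) (by rw [neg_mul_neg, hs]) z = 1 := by
  have := congrArg (eval r hr) hz
  simp only [QuadraticAlgebra.norm_def, map_add, map_sub, map_mul, ← hs, map_zero, map_one] at this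
  simp only [toComplex, RingHom.coe_mk, MonoidHom.coe_mk, OneHom.coe_mk]
  linear_combination this

lemma norm_eval_le {δ : CubicRing ℤ} {r s : ℂ} (hr : r ^ 3 = 5 * r ^ 2 - 8 * r + 3)
    (hs : s * s = eval r hr δ) (hs0 : s ≠ 0) {z : SqrtRing δ} (hz : QuadraticAlgebra.norm z = 1)
    {C : ℝ} (hC : |Real.log ‖toComplex hr hs z‖| ≤ C) :
    ‖eval r hr z.re‖ ≤ Real.exp C ∧ ‖eval r hr z.im‖ ≤ Real.exp C / ‖s‖ := by
  have h := toComplex_mul_toComplex_neg hr hs hz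
  set f := toComplex hr hs z with hf
  set g := toComplex hr (s := -s) (by rw [neg_mul_neg, hs]) z with hg
  have hf0 : 0 < ‖f‖ := norm_pos_iff.2 (left_ne_zero_of_mul_eq_one h)
  have hg1 : ‖g‖ = ‖f‖⁻¹ := by
    rw [← norm_inv, eq_inv_of_mul_eq_one_right h]
  rw [abs_le] at hC
  have h1 : ‖f‖ ≤ Real.exp C := by
    rw [← Real.log_le_iff_le_exp hf0]; exact hC.2
  have h2 : ‖g‖ ≤ Real.exp C := by
    rw [← Real.log_le_iff_le_exp (by rw [hg1]; positivity), hg1, Real.log_inv]; linarith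
  have e1 : eval r hr z.re = (f + g) / 2 := by
    simp only [hf, hg, toComplex, RingHom.coe_mk, MonoidHom.coe_mk, OneHom.coe_mk]; ring
  have e2 : eval r hr z.im = (f - g) / 2 / s := by
    simp only [hf, hg, toComplex, RingHom.coe_mk, MonoidHom.coe_mk, OneHom.coe_mk]
    field_simp; ring
  constructor
  · rw [e1, norm_div, Complex.norm_ofNat]
    linarith [norm_add_le f g]
  · rw [e2, norm_div, norm_div, Complex.norm_ofNat]
    gcongr
    linarith [norm_sub_le f g]

/-- Three units of relative norm one are multiplicatively dependent. -/
theorem exists_zpow_relation {δ δ' : CubicRing ℤ} {m : ℤ} (hm : m ≠ 0) (hδ : δ * δ' = m)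
    (u : Fin 3 → (SqrtRing δ)ˣ)
    (hu : ∀ i, QuadraticAlgebra.norm (u i : SqrtRing δ) = 1) :
    ∃ a : Fin 3 → ℤ, a ≠ 0 ∧ ∏ i, u i ^ a i = 1 := by
  obtain ⟨r, z, hr, hz, h1, h2⟩ := exists_roots
  obtain ⟨s, hs⟩ := IsAlgClosed.exists_pow_nat_eq (eval (r : ℂ) hr δ) two_pos
  obtain ⟨t, ht⟩ := IsAlgClosed.exists_pow_nat_eq (eval z hz δ) two_pos
  rw [sq] at hs ht
  have ne {x s : ℂ} (hx : x ^ 3 = 5 * x ^ 2 - 8 * x + 3) (hs : s * s = eval x hx δ) : s ≠ 0 := by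
    rintro rfl
    have := congrArg (eval x hx) hδ
    rw [map_mul, ← hs, map_intCast] at this
    simp at this
    exact hm (by exact_mod_cast this.symm)
  have hs0 := ne hr hs
  have ht0 := ne hz ht
  let f := toComplex hr hs
  let g := toComplex hz ht
  let φ : (SqrtRing δ)ˣ → Fin 2 → ℝ := fun v => ![Real.log ‖f v‖, Real.log ‖g v‖]
  have f0 (F : SqrtRing δ →+* ℂ) (v : (SqrtRing δ)ˣ) : ‖F v‖ ≠ 0 :=
    norm_ne_zero_iff.2 (v.isUnit.map F).ne_zero
  have logF (F : SqrtRing δ →+* ℂ) (a : Fin 3 → ℤ) :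
      Real.log ‖F (∏ i, u i ^ a i : (SqrtRing δ)ˣ)‖ = ∑ i, a i * Real.log ‖F (u i)‖ := by
    let L : (SqrtRing δ)ˣ →* Multiplicative ℝ :=
      { toFun := fun v => Multiplicative.ofAdd (Real.log ‖F v‖)
        map_one' := by simp
        map_mul' := fun v w => by
          rw [← ofAdd_add, Units.val_mul, map_mul, norm_mul, Real.log_mul (f0 F v) (f0 F w)] }
    have : L (∏ i, u i ^ a i) = ∏ i, L (u i) ^ a i := by simp [map_prod]
    simpa [L, Fin.prod_univ_three, Fin.sum_univ_three, ← ofAdd_zsmul, ← ofAdd_add] using this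
  have dep : ¬ LinearIndependent ℝ fun i => φ (u i) := by
    intro h
    have := h.fintype_card_le_finrank
    simp at this
  obtain ⟨c, hc, i, hi⟩ := Fintype.not_linearIndependent_iff.1 dep
  let c' : Fin 3 → ℝ := fun j => c j / c i
  have hc' : ∑ j, c' j • φ (u j) = 0 := by
    have : ∑ j, c' j • φ (u j) = (c i)⁻¹ • ∑ j, c j • φ (u j) := by
      rw [Finset.smul_sum]
      refine Finset.sum_congr rfl fun j _ => ?_
      rw [smul_smul]; congr 1; simp only [c']; ring
    rw [this, hc, smul_zero]
  let A : ℕ → Fin 3 → ℤ := fun n j => ⌊(n : ℝ) * c' j⌋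
  have hA : ∀ n, A n i = n := by
    intro n
    simp [A, c', hi]
  have bd (F : SqrtRing δ →+* ℂ) (hF : ∑ j, c' j * Real.log ‖F (u j)‖ = 0) (n : ℕ) :
      |Real.log ‖F (∏ j, u j ^ A n j : (SqrtRing δ)ˣ)‖| ≤ ∑ j, |Real.log ‖F (u j)‖| := by
    rw [logF]
    have : ∑ j, (A n j : ℝ) * Real.log ‖F (u j)‖ =
        ∑ j, ((A n j : ℝ) - n * c' j) * Real.log ‖F (u j)‖ := by
      simp only [sub_mul, Finset.sum_sub_distrib, mul_assoc, ← Finset.mul_sum, hF]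
      simp
    rw [this]
    refine (Finset.abs_sum_le_sum_abs _ _).trans (Finset.sum_le_sum fun j _ => ?_)
    rw [abs_mul]
    refine mul_le_of_le_one_left (abs_nonneg _) ?_
    rw [abs_le]
    constructor <;> linarith [Int.floor_le ((n : ℝ) * c' j), Int.lt_floor_add_one ((n : ℝ) * c' j)]
  have hf := bd f (by simpa [φ] using congrFun hc' 0)
  have hg := bd g (by simpa [φ] using congrFun hc' 1)
  set Cf := ∑ j, |Real.log ‖f (u j)‖|
  set Cg := ∑ j, |Real.log ‖g (u j)‖|
  have hnorm (n : ℕ) : QuadraticAlgebra.norm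
      ((∏ j, u j ^ A n j : (SqrtRing δ)ˣ) : SqrtRing δ) = 1 := by
    have : (∏ j, u j ^ A n j) ∈ (Units.map (QuadraticAlgebra.norm (R := CubicRing ℤ)
        (a := δ) (b := 0))).ker :=
      Subgroup.prod_mem _ fun j _ => Subgroup.zpow_mem _ (by
        rw [MonoidHom.mem_ker]; ext1; simpa using hu j) _
    rw [MonoidHom.mem_ker] at this
    have := congrArg Units.val this
    rwa [Units.coe_map] at this
  let K := max (max (Real.exp Cf) (Real.exp Cg)) (max (Real.exp Cf / ‖s‖) (Real.exp Cg / ‖t‖))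
  have fin := finite_bounded hr hz h1 h2 K
  have maps : ∀ n, ((∏ j, u j ^ A n j : (SqrtRing δ)ˣ) : SqrtRing δ) ∈
      (fun p : CubicRing ℤ × CubicRing ℤ => (⟨p.1, p.2⟩ : SqrtRing δ)) ''
        ({x | ‖eval (r : ℂ) hr x‖ ≤ K ∧ ‖eval z hz x‖ ≤ K} ×ˢ
          {x | ‖eval (r : ℂ) hr x‖ ≤ K ∧ ‖eval z hz x‖ ≤ K}) := by
    intro n
    have b1 := norm_eval_le hr hs hs0 (hnorm n) (hf n)
    have b2 := norm_eval_le hz ht ht0 (hnorm n) (hg n)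
    refine ⟨(_, _), ⟨⟨b1.1.trans ?_, b2.1.trans ?_⟩, b1.2.trans ?_, b2.2.trans ?_⟩, rfl⟩ <;>
    simp [K]
  obtain ⟨n, -, k, -, hnk, h⟩ := Set.infinite_univ.exists_ne_map_eq_of_mapsTo
    (f := fun n => ((∏ j, u j ^ A n j : (SqrtRing δ)ˣ) : SqrtRing δ))
    (fun n _ => maps n) ((fin.prod fin).image _)
  refine ⟨A n - A k, fun h0 => hnk ?_, ?_⟩
  · have := congrFun h0 i
    simp only [Pi.sub_apply, hA, Pi.zero_apply] at this
    omega
  · have := Units.ext h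
    simp only [Pi.sub_apply, zpow_sub, Finset.prod_mul_distrib, Finset.prod_inv_distrib, this]
    simp

end SqrtRing

section TwoAdic

variable {S : Type*} [CommRing S]

lemma Units.exists_zpow_eq {u : Sˣ} {X : S} (hu : (u : S) = 1 + X) (a : ℤ) :
    ∃ w, ((u ^ a : Sˣ) : S) = 1 + a * X + X ^ 2 * w := by
  have pow (v : Sˣ) (Y : S) (hv : (v : S) = 1 + Y) (n : ℕ) :
      ∃ w, ((v ^ n : Sˣ) : S) = 1 + n * Y + Y ^ 2 * w := by
    induction n with
    | zero => exact ⟨0, by simp⟩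
    | succ n ih =>
      obtain ⟨w, hw⟩ := ih
      refine ⟨n + w + Y * w, ?_⟩
      rw [pow_succ, Units.val_mul, hw, hv]
      push_cast
      ring
  have inv : ((u⁻¹ : Sˣ) : S) * (1 + X) = 1 := by rw [← hu, Units.inv_mul]
  obtain ⟨n, rfl | rfl⟩ := a.eq_nat_or_neg
  · simpa using pow u X hu n
  · obtain ⟨w, hw⟩ := pow u⁻¹ (-X * (u⁻¹ : Sˣ)) (by linear_combination inv) n
    refine ⟨n * (u⁻¹ : Sˣ) + (u⁻¹ : Sˣ) ^ 2 * w, ?_⟩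
    rw [zpow_neg, zpow_natCast, ← inv_pow, hw]
    push_cast
    linear_combination -(n : S) * X * inv

lemma Units.exists_zpow_two_pow_mul {u : Sˣ} {θ : S} {k : ℕ} (hu : (u : S) = 1 + 4 * 2 ^ k * θ)
    (s : ℕ) (b : ℤ) :
    ∃ w, ((u ^ (2 ^ s * b) : Sˣ) : S) = 1 + 4 * 2 ^ (k + s) * (b * θ + 2 * w) := by
  have pow : ∃ w, ((u ^ (2 ^ s : ℕ) : Sˣ) : S) = 1 + 4 * 2 ^ (k + s) * (θ + 2 * w) := by
    induction s with
    | zero => exact ⟨0, by simpa using hu⟩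
    | succ s ih =>
      obtain ⟨w, hw⟩ := ih
      refine ⟨w + 2 ^ (k + s) * (θ + 2 * w) ^ 2, ?_⟩
      rw [pow_succ, pow_mul, sq, Units.val_mul, hw]
      ring
  obtain ⟨w, hw⟩ := pow
  obtain ⟨w', hw'⟩ := Units.exists_zpow_eq hw b
  refine ⟨b * w + 2 * 2 ^ (k + s) * (θ + 2 * w) ^ 2 * w', ?_⟩
  rw [zpow_mul, show (2 : ℤ) ^ s = ((2 ^ s : ℕ) : ℤ) by push_cast; rfl, zpow_natCast, hw']
  ring

lemma Units.exists_zpow_of_two_pow_mul_eq {u : Sˣ} {θ : S} {k : ℕ}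
    (hu : (u : S) = 1 + 4 * 2 ^ k * θ) {t : ℕ} {a b : ℤ} (h : 2 ^ t * b = a * 2 ^ k) :
    ∃ w, ((u ^ a : Sˣ) : S) = 1 + 4 * 2 ^ t * (b * θ + 2 * w) := by
  rcases le_total k t with hkt | hkt
  · obtain ⟨s, rfl⟩ := Nat.exists_eq_add_of_le hkt
    have : a = 2 ^ s * b := by
      rw [pow_add] at h
      exact mul_right_cancel₀ (pow_ne_zero k (two_ne_zero' ℤ)) (by linear_combination -h)
    rw [this]
    exact Units.exists_zpow_two_pow_mul hu s b
  · obtain ⟨s, rfl⟩ := Nat.exists_eq_add_of_le hkt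
    have : b = 2 ^ s * a := by
      rw [pow_add] at h
      exact mul_left_cancel₀ (pow_ne_zero t (two_ne_zero' ℤ)) (by linear_combination h)
    obtain ⟨w, hw⟩ := Units.exists_zpow_two_pow_mul hu 0 a
    refine ⟨2 ^ s * w, ?_⟩
    rw [pow_zero, one_mul] at hw
    rw [hw, this]
    push_cast
    ring

/-- Units congruent to `1` modulo `4` whose first-order parts are independent modulo `2` are
multiplicatively independent. -/
theorem Units.eq_zero_of_prod_zpow_eq_one [IsAddTorsionFree S] {u : Fin 3 → Sˣ} {θ : Fin 3 → S}
    {k : Fin 3 → ℕ} (hu : ∀ i, (u i : S) = 1 + 4 * 2 ^ k i * θ i)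
    (ind : ∀ b : Fin 3 → ℤ, (2 : S) ∣ ∑ i, b i * θ i → ∀ i, 2 ∣ b i)
    {a : Fin 3 → ℤ} (ha : ∏ i, u i ^ a i = 1) : a = 0 := by
  have key (t : ℕ) : ∀ i, (2 : ℤ) ^ t ∣ a i * 2 ^ k i := by
    induction t with
    | zero => simp
    | succ t ih =>
      choose b hb using ih
      choose w hw using fun i => Units.exists_zpow_of_two_pow_mul_eq (hu i) (hb i).symm
      have h1 := congrArg Units.val ha
      simp only [Fin.prod_univ_three, Units.val_mul, hw, Units.val_one] at h1
      set x := b 0 * θ 0 + 2 * w 0 with hx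
      set y := b 1 * θ 1 + 2 * w 1 with hy
      set z := b 2 * θ 2 + 2 * w 2 with hz
      have h2 : (4 * 2 ^ t) • (x + y + z + 2 * (2 * 2 ^ t * (x * y + y * z + x * z) +
          8 * 2 ^ t * 2 ^ t * (x * y * z))) = 0 := by
        rw [nsmul_eq_mul]
        push_cast
        linear_combination h1
      have h3 := (smul_eq_zero_iff_right (by positivity)).1 h2
      have h4 := ind b ⟨-(w 0 + w 1 + w 2 + (2 * 2 ^ t * (x * y + y * z + x * z) +
          8 * 2 ^ t * 2 ^ t * (x * y * z))), by
        rw [Fin.sum_univ_three]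
        linear_combination h3 - hx - hy - hz⟩
      intro i
      rw [hb i, pow_succ]
      exact mul_dvd_mul_left _ (h4 i)
  funext i
  by_contra h0
  have h1 : a i * 2 ^ k i ≠ 0 := mul_ne_zero h0 (by positivity)
  have h2 := Int.natAbs_dvd_natAbs.2 (key (a i * 2 ^ k i).natAbs i)
  have h3 := Nat.le_of_dvd (Int.natAbs_pos.2 h1) h2
  rw [Int.natAbs_pow] at h3
  exact absurd (Nat.lt_two_pow_self (n := (a i * 2 ^ k i).natAbs)) (not_lt.2 h3)

end TwoAdic

instance : IsAddTorsionFree (CubicRing ℤ) where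
  nsmul_right_injective n hn x y h := by
    simp only [nsmul_eq_mul] at h
    have hn' : (n : ℤ) ≠ 0 := by exact_mod_cast hn
    ext
    · have := congrArg CubicRing.c0 h; simpa [hn] using this
    · have := congrArg CubicRing.c1 h; simpa [hn] using this
    · have := congrArg CubicRing.c2 h; simpa [hn] using this

instance (δ : CubicRing ℤ) : IsAddTorsionFree (SqrtRing δ) where
  nsmul_right_injective n hn x y h := by
    ext1
    · exact nsmul_right_injective hn (congrArg QuadraticAlgebra.re h)
    · exact nsmul_right_injective hn (congrArg QuadraticAlgebra.im h)

namespace SqrtRing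

variable {δ : CubicRing ℤ}

theorem not_independent_mod_two {δ' : CubicRing ℤ} {m : ℤ} (hm : m ≠ 0) (hδ : δ * δ' = m)
    {u : Fin 3 → (SqrtRing δ)ˣ} (hu : ∀ i, QuadraticAlgebra.norm (u i : SqrtRing δ) = 1)
    {θ : Fin 3 → SqrtRing δ} {k : Fin 3 → ℕ}
    (hθ : ∀ i, (u i : SqrtRing δ) = 1 + 4 * 2 ^ k i * θ i) :
    ¬ ∀ b : Fin 3 → ℤ, (2 : SqrtRing δ) ∣ ∑ i, b i * θ i → ∀ i, 2 ∣ b i := by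
  intro ind
  obtain ⟨a, ha, h⟩ := exists_zpow_relation hm hδ u hu
  exact ha (Units.eq_zero_of_prod_zpow_eq_one hθ ind h)

/-- The unit obtained from two elements of relative norm `-23` lying over the same prime. -/
theorem exists_unit_of_norm {Φ Φ₀ Θ w z : SqrtRing δ} {k : ℕ}
    (hΦ : QuadraticAlgebra.norm Φ = -23) (hΦ₀ : QuadraticAlgebra.norm Φ₀ = -23)
    (hdvd : 23 ∣ Φ * star Φ₀) (hz : Φ₀ = 1 + 4 * z)
    (hw : Φ = Φ₀ + 4 * 2 ^ k * (Θ + 2 * w)) :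
    ∃ (η : (SqrtRing δ)ˣ) (θ : SqrtRing δ), QuadraticAlgebra.norm (η : SqrtRing δ) = 1 ∧
      23 * (η : SqrtRing δ) = -(Φ * star Φ₀) ∧ (η : SqrtRing δ) = 1 + 4 * 2 ^ k * θ ∧
      2 ∣ θ - Θ := by
  obtain ⟨v, hv⟩ := hdvd
  have h0 : Φ₀ * star Φ₀ = -23 := by
    rw [← QuadraticAlgebra.algebraMap_norm_eq_mul_star, hΦ₀, map_neg, map_ofNat]
  have hsz : star Φ₀ = 1 + 4 * star z := by
    rw [hz, star_add, star_mul', star_one, star_ofNat]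
  set T := (Θ + 2 * w) * star Φ₀ with hT
  have hvT : 23 * (v + 1) = 4 * 2 ^ k * T := by
    have : Φ * star Φ₀ = Φ₀ * star Φ₀ + 4 * 2 ^ k * (Θ + 2 * w) * star Φ₀ := by rw [hw]; ring
    linear_combination -hv + this + h0
  have cop : IsCoprime (23 : ℤ) (4 * 2 ^ k) := by
    rw [show (4 : ℤ) * 2 ^ k = 2 ^ (k + 2) by ring]
    exact IsCoprime.pow_right (by rw [Int.isCoprime_iff_gcd_eq_one]; rfl)
  obtain ⟨a, b, hab⟩ := cop
  have hab' : (a : SqrtRing δ) * 23 + b * (4 * 2 ^ k) = 1 := by exact_mod_cast congrArg (Int.cast) hab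
  have hv1 : -v = 1 + 4 * 2 ^ k * (-(a * T + b * (v + 1))) - 0 := by
    linear_combination (v + 1) * hab' - a * hvT
  set θ := -(a * T + b * (v + 1)) with hθ
  have hθT : 23 * θ = -T := by
    have : (4 * 2 ^ k) • (23 * θ) = (4 * 2 ^ k) • (-T) := by
      simp only [nsmul_eq_mul]
      push_cast
      linear_combination -23 * hv1 - hvT
    exact nsmul_right_injective (by positivity) this
  have hnorm : QuadraticAlgebra.norm (-v) = 1 := by
    have h1 : QuadraticAlgebra.norm (23 * v) = 23 ^ 2 := by
      rw [← hv, map_mul, QuadraticAlgebra.norm_star, hΦ, hΦ₀]; norm_num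
    rw [map_mul] at h1
    have h2 : QuadraticAlgebra.norm (23 : SqrtRing δ) = 23 ^ 2 :=
      QuadraticAlgebra.norm_natCast 23
    rw [h2] at h1
    rw [QuadraticAlgebra.norm_neg]
    have : (23 ^ 2) • QuadraticAlgebra.norm v = (23 ^ 2) • (1 : CubicRing ℤ) := by
      simp only [nsmul_eq_mul]
      push_cast
      linear_combination h1
    exact nsmul_right_injective (by norm_num) this
  have hunit : -v * star (-v) = 1 := by
    rw [← QuadraticAlgebra.algebraMap_norm_eq_mul_star, hnorm, map_one]
  refine ⟨⟨-v, star (-v), hunit, by rw [mul_comm, hunit]⟩, θ, hnorm, ?_, ?_, ?_⟩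
  · simp only
    linear_combination hv
  · simp only
    linear_combination hv1
  · refine ⟨12 * θ + w + 2 * (Θ + 2 * w) * star z, ?_⟩
    linear_combination -hθT + hT + (Θ + 2 * w) * hsz

/-- Two elements satisfying the same linear condition modulo `23` lie over the same prime. -/
lemma dvd_mul_star {τ : CubicRing (ZMod 23)} {A B A₀ B₀ : CubicRing ℤ}
    (hτ : CubicRing.map (Int.castRingHom (ZMod 23)) δ = τ * τ)
    (h : CubicRing.map (Int.castRingHom (ZMod 23)) A =
      τ * CubicRing.map (Int.castRingHom (ZMod 23)) B)
    (h₀ : CubicRing.map (Int.castRingHom (ZMod 23)) A₀ =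
      τ * CubicRing.map (Int.castRingHom (ZMod 23)) B₀) :
    (23 : SqrtRing δ) ∣ (⟨A, B⟩ : SqrtRing δ) * star (⟨A₀, B₀⟩ : SqrtRing δ) := by
  have dvd (x : CubicRing ℤ) (hx : CubicRing.map (Int.castRingHom (ZMod 23)) x = 0) :
      ∃ y, x = 23 * y := by
    have h0 : (x.c0 : ZMod 23) = 0 := congrArg CubicRing.c0 hx
    have h1 : (x.c1 : ZMod 23) = 0 := congrArg CubicRing.c1 hx
    have h2 : (x.c2 : ZMod 23) = 0 := congrArg CubicRing.c2 hx
    rw [ZMod.intCast_zmod_eq_zero_iff_dvd] at h0 h1 h2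
    obtain ⟨a, ha⟩ := h0
    obtain ⟨b, hb⟩ := h1
    obtain ⟨c, hc⟩ := h2
    exact ⟨⟨a, b, c⟩, by ext <;> simp [ha, hb, hc]⟩
  obtain ⟨y, hy⟩ := dvd (A * A₀ - δ * B * B₀) (by
    rw [map_sub, map_mul, map_mul, map_mul, h, h₀, hτ]; ring)
  obtain ⟨y', hy'⟩ := dvd (B * A₀ - A * B₀) (by
    rw [map_sub, map_mul, map_mul, h, h₀]; ring)
  refine ⟨⟨y, y'⟩, ?_⟩
  ext1
  · simp only [QuadraticAlgebra.re_mul, QuadraticAlgebra.re_star, QuadraticAlgebra.im_star,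
      QuadraticAlgebra.re_ofNat, QuadraticAlgebra.im_ofNat]
    linear_combination hy
  · simp only [QuadraticAlgebra.im_mul, QuadraticAlgebra.re_star, QuadraticAlgebra.im_star,
      QuadraticAlgebra.re_ofNat, QuadraticAlgebra.im_ofNat]
    linear_combination hy'

end SqrtRing

namespace CubicRing

/-- The data describing a curve covering the cubic `x ^ 3 - x = y * (x + y) * (x + y - 1)`
together with a linear form on it. -/
structure Shape (R : Type*) where
  m : R
  n : R
  α : R
  δ : CubicRing R
  v₁ : CubicRing R
  v₂ : CubicRing R
  v₃ : CubicRing R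

variable {R : Type*} [CommRing R]

namespace Shape

/-- The covering with twist `α`. -/
def one (α : R) : Shape R := ⟨1, 3, α, ⟨0, α, 0⟩, ⟨4, -4, 1⟩, ⟨8, -5, 1⟩, ⟨-1, 0, 0⟩⟩

/-- The covering with twist `3 * α`. -/
def three (α : R) : Shape R :=
  ⟨3, 1, α, ⟨8 * α, -5 * α, α⟩, ⟨3, -4, 1⟩, ⟨1, 0, 0⟩, ⟨0, -1, 0⟩⟩

variable (S : Shape R)

/-- The points of the covering. -/
structure IsPoint (x y a b c : R) : Prop where
  curve : x ^ 3 - x = y * (x + y) * (x + y - 1)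
  r11 : S.m * S.α * a ^ 2 = x * (x - y + 1)
  r12 : S.α * (a * b) = x * y
  r13 : S.m * S.α * (a * c) = y * (x - y + 1)
  r22 : S.n * S.α * b ^ 2 = x ^ 2 - x + y ^ 2
  r23 : S.α * (b * c) = y ^ 2
  r33 : S.m * S.α * c ^ 2 = 1 - y - x ^ 2 + x * y + 3 * y ^ 2

/-- The linear form. -/
def form (a b c : R) : CubicRing R := scalar a * S.v₁ + scalar b * S.v₂ + scalar c * S.v₃

/-- The bilinear companion of the linear form. -/
def slope (x a b c : R) : CubicRing R :=
  S.form a b c + 2 * (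
    S.form (-2 * a - 2 * S.n * b + c) (2 * S.m * a + 2 * b) (3 * a + 2 * S.n * b - c) +
    scalar x * S.form (2 * a - 3 * S.n * b + 5 * c) (-3 * S.m * a + b - 2 * S.m * c)
      (-5 * a + 2 * S.n * b - 4 * c))

/-- A function on the covering of relative norm `-23`. -/
def phi (x a b c : R) : SqrtRing S.δ :=
  ⟨8 * (S.δ * S.form a b c ^ 2) - 19, 4 * S.slope x a b c⟩

end Shape

lemma delta_mul_form_sq_one {α x y a b c : R} (h : (Shape.one α).IsPoint x y a b c) :
    (Shape.one α).δ * ((Shape.one α).form a b c) ^ 2 =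
      ⟨11 * x ^ 2 + 15 * x * y - 5 * x + 8 * y ^ 2 - 6 * y,
      -7 * x ^ 2 - 14 * x * y + 4 * x - 10 * y ^ 2 + 7 * y + 1,
      x ^ 2 + 4 * x * y - x + 3 * y ^ 2 - 2 * y⟩ := by
  have h11 := h.r11
  have h12 := h.r12
  have h13 := h.r13
  have h22 := h.r22
  have h23 := h.r23
  have h33 := h.r33
  simp only [Shape.one] at h11 h12 h13 h22 h23 h33
  ext
  · simp [Shape.one, Shape.form, scalar, sq]
    linear_combination (3) * h11 + (24) * h12 + (-6) * h13 + (8) * h22 + (-6) * h23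
  · simp [Shape.one, Shape.form, scalar, sq]
    linear_combination (-1) * h11 + (-24) * h12 + (8) * h13 + (-5) * h22 + (1) * h33
  · simp [Shape.one, Shape.form, scalar, sq]
    linear_combination (6) * h12 + (-2) * h13 + (1) * h22

lemma delta_mul_slope_sq_one {α x y a b c : R} (h : (Shape.one α).IsPoint x y a b c) :
    (Shape.one α).δ * ((Shape.one α).slope x a b c) ^ 2 =
      ⟨656 * x ^ 4 + 588 * x ^ 3 * y - 340 * x ^ 3 + 200 * x ^ 2 * y ^ 2 - 300 * x ^ 2 * y - 401 * x ^ 2 - 44 * x * y ^ 2 - 189 * x * y + 115 * x - 76 * y ^ 2 + 66 * y + 24,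
      -612 * x ^ 4 - 324 * x ^ 3 * y + 252 * x ^ 3 - 52 * x ^ 2 * y ^ 2 + 180 * x ^ 2 * y + 401 * x ^ 2 + 28 * x * y ^ 2 + 106 * x * y - 80 * x + 58 * y ^ 2 - 53 * y - 19,
      152 * x ^ 4 + 44 * x ^ 3 * y - 52 * x ^ 3 + 4 * x ^ 2 * y ^ 2 - 36 * x ^ 2 * y - 103 * x ^ 2 - 4 * x * y ^ 2 - 12 * x * y + 15 * x - 17 * y ^ 2 + 14 * y + 4⟩ := by
  have h11 := h.r11
  have h12 := h.r12
  have h13 := h.r13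
  have h22 := h.r22
  have h23 := h.r23
  have h33 := h.r33
  simp only [Shape.one] at h11 h12 h13 h22 h23 h33
  ext
  · simp [Shape.one, Shape.form, Shape.slope, scalar, sq]
    linear_combination (216 * x ^ 2 - 276 * x + 87) * h11 + (960 * x ^ 2 - 456 * x - 156) * h12 + (-168 * x ^ 2 + 90) * h13 + (452 * x ^ 2 + 232 * x + 32) * h22 + (-456 * x ^ 2 - 456 * x - 90) * h23 + (12 * x ^ 2 + 60 * x + 24) * h33
  · simp [Shape.one, Shape.form, Shape.slope, scalar, sq]
    linear_combination (-200 * x ^ 2 + 240 * x - 69) * h11 + (-696 * x ^ 2 + 408 * x + 120) * h12 + (128 * x ^ 2 - 32 * x - 72) * h13 + (-368 * x ^ 2 - 196 * x - 29) * h22 + (312 * x ^ 2 + 312 * x + 72) * h23 + (44 * x ^ 2 - 40 * x - 19) * h33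
  · simp [Shape.one, Shape.form, Shape.slope, scalar, sq]
    linear_combination (44 * x ^ 2 - 48 * x + 12) * h11 + (168 * x ^ 2 - 96 * x - 42) * h12 + (-48 * x ^ 2 + 24 * x + 18) * h13 + (76 * x ^ 2 + 32 * x + 1) * h22 + (-24 * x ^ 2 - 24 * x - 12) * h23 + (-32 * x ^ 2 + 4 * x + 4) * h33

lemma delta_mul_form_sq_three {α x y a b c : R} (h : (Shape.three α).IsPoint x y a b c) :
    (Shape.three α).δ * ((Shape.three α).form a b c) ^ 2 =
      ⟨11 * x ^ 2 + 15 * x * y - 5 * x + 8 * y ^ 2 - 6 * y,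
      -7 * x ^ 2 - 14 * x * y + 4 * x - 10 * y ^ 2 + 7 * y + 1,
      x ^ 2 + 4 * x * y - x + 3 * y ^ 2 - 2 * y⟩ := by
  have h11 := h.r11
  have h12 := h.r12
  have h13 := h.r13
  have h22 := h.r22
  have h23 := h.r23
  have h33 := h.r33
  simp only [Shape.three] at h11 h12 h13 h22 h23 h33
  ext
  · simp [Shape.three, Shape.form, scalar, sq]
    linear_combination (3) * h11 + (24) * h12 + (-6) * h13 + (8) * h22 + (-6) * h23
  · simp [Shape.three, Shape.form, scalar, sq]
    linear_combination (-1) * h11 + (-24) * h12 + (8) * h13 + (-5) * h22 + (1) * h33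
  · simp [Shape.three, Shape.form, scalar, sq]
    linear_combination (6) * h12 + (-2) * h13 + (1) * h22

lemma delta_mul_slope_sq_three {α x y a b c : R} (h : (Shape.three α).IsPoint x y a b c) :
    (Shape.three α).δ * ((Shape.three α).slope x a b c) ^ 2 =
      ⟨656 * x ^ 4 + 588 * x ^ 3 * y - 340 * x ^ 3 + 200 * x ^ 2 * y ^ 2 - 300 * x ^ 2 * y - 401 * x ^ 2 - 44 * x * y ^ 2 - 189 * x * y + 115 * x - 76 * y ^ 2 + 66 * y + 24,
      -612 * x ^ 4 - 324 * x ^ 3 * y + 252 * x ^ 3 - 52 * x ^ 2 * y ^ 2 + 180 * x ^ 2 * y + 401 * x ^ 2 + 28 * x * y ^ 2 + 106 * x * y - 80 * x + 58 * y ^ 2 - 53 * y - 19,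
      152 * x ^ 4 + 44 * x ^ 3 * y - 52 * x ^ 3 + 4 * x ^ 2 * y ^ 2 - 36 * x ^ 2 * y - 103 * x ^ 2 - 4 * x * y ^ 2 - 12 * x * y + 15 * x - 17 * y ^ 2 + 14 * y + 4⟩ := by
  have h11 := h.r11
  have h12 := h.r12
  have h13 := h.r13
  have h22 := h.r22
  have h23 := h.r23
  have h33 := h.r33
  simp only [Shape.three] at h11 h12 h13 h22 h23 h33
  ext
  · simp [Shape.three, Shape.form, Shape.slope, scalar, sq]
    linear_combination (216 * x ^ 2 - 276 * x + 87) * h11 + (960 * x ^ 2 - 456 * x - 156) * h12 + (-168 * x ^ 2 + 90) * h13 + (452 * x ^ 2 + 232 * x + 32) * h22 + (-456 * x ^ 2 - 456 * x - 90) * h23 + (12 * x ^ 2 + 60 * x + 24) * h33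
  · simp [Shape.three, Shape.form, Shape.slope, scalar, sq]
    linear_combination (-200 * x ^ 2 + 240 * x - 69) * h11 + (-696 * x ^ 2 + 408 * x + 120) * h12 + (128 * x ^ 2 - 32 * x - 72) * h13 + (-368 * x ^ 2 - 196 * x - 29) * h22 + (312 * x ^ 2 + 312 * x + 72) * h23 + (44 * x ^ 2 - 40 * x - 19) * h33
  · simp [Shape.three, Shape.form, Shape.slope, scalar, sq]
    linear_combination (44 * x ^ 2 - 48 * x + 12) * h11 + (168 * x ^ 2 - 96 * x - 42) * h12 + (-48 * x ^ 2 + 24 * x + 18) * h13 + (76 * x ^ 2 + 32 * x + 1) * h22 + (-24 * x ^ 2 - 24 * x - 12) * h23 + (-32 * x ^ 2 + 4 * x + 4) * h33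

lemma sq_sub_of_curve {x y : R} (h : x ^ 3 - x = y * (x + y) * (x + y - 1)) {X Y : CubicRing R}
    (hX : X =
      ⟨11 * x ^ 2 + 15 * x * y - 5 * x + 8 * y ^ 2 - 6 * y,
      -7 * x ^ 2 - 14 * x * y + 4 * x - 10 * y ^ 2 + 7 * y + 1,
      x ^ 2 + 4 * x * y - x + 3 * y ^ 2 - 2 * y⟩)
    (hY : Y =
      ⟨656 * x ^ 4 + 588 * x ^ 3 * y - 340 * x ^ 3 + 200 * x ^ 2 * y ^ 2 - 300 * x ^ 2 * y - 401 * x ^ 2 - 44 * x * y ^ 2 - 189 * x * y + 115 * x - 76 * y ^ 2 + 66 * y + 24,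
      -612 * x ^ 4 - 324 * x ^ 3 * y + 252 * x ^ 3 - 52 * x ^ 2 * y ^ 2 + 180 * x ^ 2 * y + 401 * x ^ 2 + 28 * x * y ^ 2 + 106 * x * y - 80 * x + 58 * y ^ 2 - 53 * y - 19,
      152 * x ^ 4 + 44 * x ^ 3 * y - 52 * x ^ 3 + 4 * x ^ 2 * y ^ 2 - 36 * x ^ 2 * y - 103 * x ^ 2 - 4 * x * y ^ 2 - 12 * x * y + 15 * x - 17 * y ^ 2 + 14 * y + 4⟩) :
    (8 * X - 19) ^ 2 - 16 * Y = -23 := by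
  subst hX hY
  ext
  · simp [sq]
    linear_combination (-4480 * x - 1216 * y + 704) * h
  · simp [sq]
    linear_combination (4736 * x + 832 * y - 448) * h
  · simp [sq]
    linear_combination (-1280 * x - 64 * y + 64) * h

namespace Shape

lemma norm_phi_one {α x y a b c : R} (h : (one α).IsPoint x y a b c) :
    QuadraticAlgebra.norm ((one α).phi x a b c) = -23 := by
  rw [QuadraticAlgebra.norm_def, phi]
  have := sq_sub_of_curve h.curve (delta_mul_form_sq_one h) (delta_mul_slope_sq_one h)
  linear_combination this

lemma norm_phi_three {α x y a b c : R} (h : (three α).IsPoint x y a b c) :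
    QuadraticAlgebra.norm ((three α).phi x a b c) = -23 := by
  rw [QuadraticAlgebra.norm_def, phi]
  have := sq_sub_of_curve h.curve (delta_mul_form_sq_three h) (delta_mul_slope_sq_three h)
  linear_combination this

variable (S : Shape R)

lemma phi_eq (x a b c : R) : S.phi x a b c =
    1 + 4 * ⟨2 * (S.δ * S.form a b c ^ 2) - 5, S.slope x a b c⟩ := by
  ext1
  · simp only [phi, QuadraticAlgebra.re_add, QuadraticAlgebra.re_one, QuadraticAlgebra.re_mul,
      QuadraticAlgebra.re_ofNat, QuadraticAlgebra.im_ofNat]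
    ring
  · simp only [phi, QuadraticAlgebra.im_add, QuadraticAlgebra.im_one, QuadraticAlgebra.im_mul,
      QuadraticAlgebra.re_ofNat, QuadraticAlgebra.im_ofNat]
    ring

lemma phi_neg (x a b c : R) : S.phi x (-a) (-b) (-c) = star (S.phi x a b c) := by
  ext1
  · simp only [phi, form, slope, map_neg, QuadraticAlgebra.re_star]
    ring
  · simp only [phi, form, slope, map_neg, map_add, map_sub, map_mul, QuadraticAlgebra.im_star]
    ring

lemma IsPoint.neg {S : Shape R} {x y a b c : R} (h : S.IsPoint x y a b c) :
    S.IsPoint x y (-a) (-b) (-c) where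
  curve := h.curve
  r11 := by rw [neg_sq, h.r11]
  r12 := by rw [neg_mul_neg, h.r12]
  r13 := by rw [neg_mul_neg, h.r13]
  r22 := by rw [neg_sq, h.r22]
  r23 := by rw [neg_mul_neg, h.r23]
  r33 := by rw [neg_sq, h.r33]

lemma exists_phi_add_eq (x a b c u d e f : R) (k : ℕ) :
    ∃ w, S.phi (x + 2 ^ k * u) (a + 2 ^ k * d) (b + 2 ^ k * e) (c + 2 ^ k * f) =
      S.phi x a b c + 4 * 2 ^ k * (⟨0, S.form d e f⟩ + 2 * w) := by
  refine ⟨⟨S.δ * (2 * S.form a b c * S.form d e f + 2 ^ k * S.form d e f ^ 2),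
    S.form (-2 * d - 2 * S.n * e + f) (2 * S.m * d + 2 * e) (3 * d + 2 * S.n * e - f) +
    scalar (x + 2 ^ k * u) * S.form (2 * d - 3 * S.n * e + 5 * f)
      (-3 * S.m * d + e - 2 * S.m * f) (-5 * d + 2 * S.n * e - 4 * f) +
    scalar u * S.form (2 * a - 3 * S.n * b + 5 * c) (-3 * S.m * a + b - 2 * S.m * c)
      (-5 * a + 2 * S.n * b - 4 * c)⟩, ?_⟩
  have h2 : (4 * 2 ^ k : SqrtRing S.δ) = QuadraticAlgebra.C (4 * 2 ^ k) := by
    rw [QuadraticAlgebra.C_mul, QuadraticAlgebra.C_pow, QuadraticAlgebra.C_ofNat,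
      QuadraticAlgebra.C_ofNat]
  rw [h2]
  ext1
  · simp only [phi, form, map_add, map_mul, map_pow, map_ofNat, QuadraticAlgebra.re_add,
      QuadraticAlgebra.re_mul, QuadraticAlgebra.re_C, QuadraticAlgebra.im_C,
      QuadraticAlgebra.re_ofNat, QuadraticAlgebra.im_ofNat, QuadraticAlgebra.im_add]
    ring
  · simp only [phi, form, slope, map_add, map_sub, map_neg, map_mul, map_pow, map_ofNat,
      QuadraticAlgebra.im_add,
      QuadraticAlgebra.re_add, QuadraticAlgebra.im_mul, QuadraticAlgebra.re_C,
      QuadraticAlgebra.im_C, QuadraticAlgebra.re_ofNat, QuadraticAlgebra.im_ofNat]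
    ring

end Shape

end CubicRing

namespace CubicRing

namespace Shape

variable {R R' : Type*} [CommRing R] [CommRing R']

/-- Base change of a shape. -/
def map (f : R →+* R') (S : Shape R) : Shape R' :=
  ⟨f S.m, f S.n, f S.α, CubicRing.map f S.δ, CubicRing.map f S.v₁, CubicRing.map f S.v₂,
    CubicRing.map f S.v₃⟩

lemma map_one (f : R →+* R') (α : R) : (one α).map f = one (f α) := by
  simp [map, one, CubicRing.map, map_ofNat f]

lemma map_three (f : R →+* R') (α : R) : (three α).map f = three (f α) := by
  simp [map, three, CubicRing.map, map_ofNat f]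

lemma map_form (f : R →+* R') (S : Shape R) (a b c : R) :
    CubicRing.map f (S.form a b c) = (S.map f).form (f a) (f b) (f c) := by
  have hs (r : R) : CubicRing.map f (scalar r) = scalar (f r) := by
    ext <;> simp [CubicRing.map, scalar]
  simp [form, map, hs]

lemma map_slope (f : R →+* R') (S : Shape R) (x a b c : R) :
    CubicRing.map f (S.slope x a b c) = (S.map f).slope (f x) (f a) (f b) (f c) := by
  have hs (r : R) : CubicRing.map f (scalar r) = scalar (f r) := by
    ext <;> simp [CubicRing.map, scalar]
  simp only [slope, map_add, map_mul, map_form, hs, map_sub, map_neg, map_ofNat]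
  simp [map]

lemma IsPoint.map (f : R →+* R') {S : Shape R} {x y a b c : R} (h : S.IsPoint x y a b c) :
    (S.map f).IsPoint (f x) (f y) (f a) (f b) (f c) where
  curve := by simpa using congrArg f h.curve
  r11 := by simpa [Shape.map] using congrArg f h.r11
  r12 := by simpa [Shape.map] using congrArg f h.r12
  r13 := by simpa [Shape.map] using congrArg f h.r13
  r22 := by simpa [Shape.map] using congrArg f h.r22
  r23 := by simpa [Shape.map] using congrArg f h.r23
  r33 := by simpa [Shape.map, map_ofNat f] using congrArg f h.r33

/-- The two coordinates of `S.phi` are proportional with ratio `τ`. -/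
def Compat (S : Shape R) (τ : CubicRing R) (x a b c : R) : Prop :=
  8 * (S.δ * S.form a b c ^ 2) - 19 = τ * (4 * S.slope x a b c)

instance [DecidableEq R] (S : Shape R) (τ : CubicRing R) (x a b c : R) :
    Decidable (S.Compat τ x a b c) :=
  inferInstanceAs (Decidable (_ = _))

lemma dvd_phi_mul_star {S : Shape ℤ} {τ : CubicRing (ZMod 23)} {x a b c x₀ a₀ b₀ c₀ : ℤ}
    (hτ : (S.map (Int.castRingHom (ZMod 23))).δ = τ * τ)
    (h : (S.map (Int.castRingHom (ZMod 23))).Compat τ x a b c)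
    (h₀ : (S.map (Int.castRingHom (ZMod 23))).Compat τ x₀ a₀ b₀ c₀) :
    23 ∣ S.phi x a b c * star (S.phi x₀ a₀ b₀ c₀) := by
  refine SqrtRing.dvd_mul_star hτ ?_ ?_
  · simp only [map_sub, map_mul, map_pow, map_form, map_slope, map_ofNat]
    exact h
  · simp only [map_sub, map_mul, map_pow, map_form, map_slope, map_ofNat]
    exact h₀

/-- The unit attached to two points that are close `2`-adically. -/
theorem exists_unit {S : Shape ℤ} {τ : CubicRing (ZMod 23)} {x a b c u d e f : ℤ} {k : ℕ}
    (hτ : (S.map (Int.castRingHom (ZMod 23))).δ = τ * τ)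
    (hn : QuadraticAlgebra.norm (S.phi x a b c) = -23)
    (hn' : QuadraticAlgebra.norm
      (S.phi (x + 2 ^ k * u) (a + 2 ^ k * d) (b + 2 ^ k * e) (c + 2 ^ k * f)) = -23)
    (hc : (S.map (Int.castRingHom (ZMod 23))).Compat τ x a b c)
    (hc' : (S.map (Int.castRingHom (ZMod 23))).Compat τ ((x + 2 ^ k * u : ℤ) : ZMod 23)
      ((a + 2 ^ k * d : ℤ) : ZMod 23) ((b + 2 ^ k * e : ℤ) : ZMod 23)
      ((c + 2 ^ k * f : ℤ) : ZMod 23)) :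
    ∃ (η : (SqrtRing S.δ)ˣ) (θ : SqrtRing S.δ), QuadraticAlgebra.norm (η : SqrtRing S.δ) = 1 ∧
      23 * (η : SqrtRing S.δ) =
        -(S.phi (x + 2 ^ k * u) (a + 2 ^ k * d) (b + 2 ^ k * e) (c + 2 ^ k * f) *
          star (S.phi x a b c)) ∧
      (η : SqrtRing S.δ) = 1 + 4 * 2 ^ k * θ ∧ 2 ∣ θ - ⟨0, S.form d e f⟩ := by
  obtain ⟨w, hw⟩ := S.exists_phi_add_eq x a b c u d e f k
  exact SqrtRing.exists_unit_of_norm hn' hn (dvd_phi_mul_star hτ hc' hc) (S.phi_eq x a b c) hw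

/-- Two points that are close `2`-adically give a unit whose first-order part depends on the
first-order parts of two given units. -/
theorem not_independent {S : Shape ℤ} {δ' : CubicRing ℤ} {m : ℤ} (hm : m ≠ 0) (hδ : S.δ * δ' = m)
    {g₁ g₂ : (SqrtRing S.δ)ˣ} (hg₁ : QuadraticAlgebra.norm (g₁ : SqrtRing S.δ) = 1)
    (hg₂ : QuadraticAlgebra.norm (g₂ : SqrtRing S.δ) = 1) {θ₁ θ₂ : SqrtRing S.δ}
    (hθ₁ : (g₁ : SqrtRing S.δ) = 1 + 4 * θ₁) (hθ₂ : (g₂ : SqrtRing S.δ) = 1 + 4 * θ₂)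
    {τ : CubicRing (ZMod 23)} {x a b c u d e f : ℤ} {k : ℕ}
    (hτ : (S.map (Int.castRingHom (ZMod 23))).δ = τ * τ)
    (hn : QuadraticAlgebra.norm (S.phi x a b c) = -23)
    (hn' : QuadraticAlgebra.norm
      (S.phi (x + 2 ^ k * u) (a + 2 ^ k * d) (b + 2 ^ k * e) (c + 2 ^ k * f)) = -23)
    (hc : (S.map (Int.castRingHom (ZMod 23))).Compat τ x a b c)
    (hc' : (S.map (Int.castRingHom (ZMod 23))).Compat τ ((x + 2 ^ k * u : ℤ) : ZMod 23)
      ((a + 2 ^ k * d : ℤ) : ZMod 23) ((b + 2 ^ k * e : ℤ) : ZMod 23)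
      ((c + 2 ^ k * f : ℤ) : ZMod 23)) :
    ¬ ∀ r s t : ZMod 2,
      r * θ₁.im.c0 + s * θ₂.im.c0 + t * (S.form d e f).c0 = 0 →
      r * θ₁.im.c1 + s * θ₂.im.c1 + t * (S.form d e f).c1 = 0 →
      r * θ₁.im.c2 + s * θ₂.im.c2 + t * (S.form d e f).c2 = 0 → r = 0 ∧ s = 0 ∧ t = 0 := by
  intro ind
  obtain ⟨η, θ, hη, -, hηθ, v, hv⟩ := exists_unit hτ hn hn' hc hc'
  refine SqrtRing.not_independent_mod_two (u := ![g₁, g₂, η]) (θ := ![θ₁, θ₂, θ])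
    (k := ![0, 0, k]) hm hδ ?_ ?_ ?_
  · intro i
    fin_cases i
    exacts [hg₁, hg₂, hη]
  · intro i
    fin_cases i
    · simpa using hθ₁
    · simpa using hθ₂
    · exact hηθ
  · intro z hz
    have h2 : (2 : SqrtRing S.δ) ∣ z 0 * θ₁ + z 1 * θ₂ + z 2 * ⟨0, S.form d e f⟩ := by
      rw [Fin.sum_univ_three] at hz
      obtain ⟨t, ht⟩ := hz
      simp only [Matrix.cons_val] at ht
      exact ⟨t - z 2 * v, by linear_combination ht - z 2 * hv⟩
    obtain ⟨t, ht⟩ := h2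
    have him := congrArg QuadraticAlgebra.im ht
    simp only [QuadraticAlgebra.im_add, QuadraticAlgebra.im_mul, QuadraticAlgebra.re_intCast,
      QuadraticAlgebra.im_intCast, QuadraticAlgebra.re_ofNat, QuadraticAlgebra.im_ofNat] at him
    have h0 := congrArg (fun w : CubicRing ℤ => (w.c0 : ZMod 2)) him
    have h1 := congrArg (fun w : CubicRing ℤ => (w.c1 : ZMod 2)) him
    have h2 := congrArg (fun w : CubicRing ℤ => (w.c2 : ZMod 2)) him
    have two : (2 : ZMod 2) = 0 := rfl
    simp [two] at h0 h1 h2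
    have := ind (z 0) (z 1) (z 2) h0 h1 h2
    simp only [ZMod.intCast_zmod_eq_zero_iff_dvd] at this
    intro i
    fin_cases i
    · exact this.1
    · exact this.2.1
    · exact this.2.2

end Shape

end CubicRing

namespace CubicRing

namespace Shape

lemma IsPoint.search {R : Type*} [CommRing R] {S : Shape R} {P : R → R → R → R → R → Prop}
    {x y a b c : R} (h : S.IsPoint x y a b c)
    (hP : ∀ x y, x ^ 3 - x = y * (x + y) * (x + y - 1) →
      ∀ a, S.m * S.α * a ^ 2 = x * (x - y + 1) →
      ∀ b, S.α * (a * b) = x * y → S.n * S.α * b ^ 2 = x ^ 2 - x + y ^ 2 →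
      ∀ c, S.m * S.α * (a * c) = y * (x - y + 1) → S.α * (b * c) = y ^ 2 →
        S.m * S.α * c ^ 2 = 1 - y - x ^ 2 + x * y + 3 * y ^ 2 → P x y a b c) : P x y a b c :=
  hP x y h.curve a h.r11 b h.r12 h.r22 c h.r13 h.r23 h.r33

/-- An element of relative norm one as a unit. -/
def unitOfNorm {δ : CubicRing ℤ} (z : SqrtRing δ) (hz : QuadraticAlgebra.norm z = 1) :
    (SqrtRing δ)ˣ where
  val := z
  inv := star z
  val_inv := by rw [← QuadraticAlgebra.algebraMap_norm_eq_mul_star, hz, _root_.map_one]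
  inv_val := by rw [mul_comm, ← QuadraticAlgebra.algebraMap_norm_eq_mul_star, hz, _root_.map_one]

lemma norm_unitOfNorm {δ : CubicRing ℤ} (z : SqrtRing δ) (hz : QuadraticAlgebra.norm z = 1) :
    QuadraticAlgebra.norm (unitOfNorm z hz : SqrtRing δ) = 1 :=
  hz

lemma compat_or_compat_neg_one {x y a b c : ZMod 23} (h : (one 1 : Shape (ZMod 23)).IsPoint x y a b c) :
    (one 1 : Shape (ZMod 23)).Compat ⟨11, 19, 3⟩ x a b c ∨
      (one 1 : Shape (ZMod 23)).Compat ⟨11, 19, 3⟩ x (-a) (-b) (-c) :=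
  h.search (P := fun x _ a b c => (one 1 : Shape (ZMod 23)).Compat ⟨11, 19, 3⟩ x a b c ∨
    (one 1 : Shape (ZMod 23)).Compat ⟨11, 19, 3⟩ x (-a) (-b) (-c)) (by decide +kernel)

theorem not_odd_of_compat_one {x y y' a b c u d e f : ℤ} {k : ℕ}
    (h : (one 1 : Shape ℤ).IsPoint x y a b c)
    (h' : (one 1 : Shape ℤ).IsPoint (x + 2 ^ k * u) y' (a + 2 ^ k * d) (b + 2 ^ k * e)
      (c + 2 ^ k * f))
    (hc : (one 1 : Shape (ZMod 23)).Compat ⟨11, 19, 3⟩ x a b c)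
    (hc' : (one 1 : Shape (ZMod 23)).Compat ⟨11, 19, 3⟩ ((x + 2 ^ k * u : ℤ) : ZMod 23)
      ((a + 2 ^ k * d : ℤ) : ZMod 23) ((b + 2 ^ k * e : ℤ) : ZMod 23)
      ((c + 2 ^ k * f : ℤ) : ZMod 23)) : ¬ Odd f := by
  intro hodd
  have hS : (one 1 : Shape ℤ).map (Int.castRingHom (ZMod 23)) = one 1 := by
    rw [map_one, _root_.map_one]
  refine not_independent (S := one 1) (δ' := ⟨8, -5, 1⟩) (m := 3) (by norm_num) (by decide +kernel)
    (norm_unitOfNorm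
      (⟨⟨673, -536, 120⟩, ⟨-920, 732, -164⟩⟩ : SqrtRing (one 1 : Shape ℤ).δ) (by decide +kernel))
    (norm_unitOfNorm
      (⟨⟨25, -8, 0⟩, ⟨-40, 24, -4⟩⟩ : SqrtRing (one 1 : Shape ℤ).δ) (by decide +kernel))
    (θ₁ := ⟨⟨168, -134, 30⟩, ⟨-230, 183, -41⟩⟩)
    (θ₂ := ⟨⟨6, -2, 0⟩, ⟨-10, 6, -1⟩⟩)
    (by decide +kernel) (by decide +kernel) (τ := ⟨11, 19, 3⟩) (by decide +kernel) (norm_phi_one h) (norm_phi_one h')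
    (by rw [hS]; exact hc) (by rw [hS]; exact hc') ?_
  intro r s t h0 h1 h2
  simp [form, one, scalar] at h0 h1 h2
  rw [← ZMod.intCast_eq_one_iff_odd] at hodd
  revert h0 h1 h2 hodd
  generalize (d : ZMod 2) = d
  generalize (e : ZMod 2) = e
  generalize (f : ZMod 2) = f
  revert r s t d e f
  decide +kernel

lemma compat_or_compat_neg_two {x y a b c : ZMod 23} (h : (one 2 : Shape (ZMod 23)).IsPoint x y a b c) :
    (one 2 : Shape (ZMod 23)).Compat ⟨14, 20, 8⟩ x a b c ∨
      (one 2 : Shape (ZMod 23)).Compat ⟨14, 20, 8⟩ x (-a) (-b) (-c) :=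
  h.search (P := fun x _ a b c => (one 2 : Shape (ZMod 23)).Compat ⟨14, 20, 8⟩ x a b c ∨
    (one 2 : Shape (ZMod 23)).Compat ⟨14, 20, 8⟩ x (-a) (-b) (-c)) (by decide +kernel)

theorem not_odd_of_compat_two {x y y' a b c u d e f : ℤ} {k : ℕ}
    (h : (one 2 : Shape ℤ).IsPoint x y a b c)
    (h' : (one 2 : Shape ℤ).IsPoint (x + 2 ^ k * u) y' (a + 2 ^ k * d) (b + 2 ^ k * e)
      (c + 2 ^ k * f))
    (hc : (one 2 : Shape (ZMod 23)).Compat ⟨14, 20, 8⟩ x a b c)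
    (hc' : (one 2 : Shape (ZMod 23)).Compat ⟨14, 20, 8⟩ ((x + 2 ^ k * u : ℤ) : ZMod 23)
      ((a + 2 ^ k * d : ℤ) : ZMod 23) ((b + 2 ^ k * e : ℤ) : ZMod 23)
      ((c + 2 ^ k * f : ℤ) : ZMod 23)) : ¬ Odd d := by
  intro hodd
  have hS : (one 2 : Shape ℤ).map (Int.castRingHom (ZMod 23)) = one 2 := by
    rw [map_one, map_ofNat]
  refine not_independent (S := one 2) (δ' := ⟨8, -5, 1⟩) (m := 6) (by norm_num) (by decide +kernel)
    (norm_unitOfNorm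
      (⟨⟨2881, -2288, 512⟩, ⟨-2788, 2216, -496⟩⟩ : SqrtRing (one 2 : Shape ℤ).δ) (by decide +kernel))
    (norm_unitOfNorm
      (⟨⟨1, 16, -16⟩, ⟨-8, 4, 4⟩⟩ : SqrtRing (one 2 : Shape ℤ).δ) (by decide +kernel))
    (θ₁ := ⟨⟨720, -572, 128⟩, ⟨-697, 554, -124⟩⟩)
    (θ₂ := ⟨⟨0, 4, -4⟩, ⟨-2, 1, 1⟩⟩)
    (by decide +kernel) (by decide +kernel) (τ := ⟨14, 20, 8⟩) (by decide +kernel) (norm_phi_one h) (norm_phi_one h')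
    (by rw [hS]; exact hc) (by rw [hS]; exact hc') ?_
  intro r s t h0 h1 h2
  simp [form, one, scalar] at h0 h1 h2
  rw [← ZMod.intCast_eq_one_iff_odd] at hodd
  revert h0 h1 h2 hodd
  generalize (d : ZMod 2) = d
  generalize (e : ZMod 2) = e
  generalize (f : ZMod 2) = f
  revert r s t d e f
  decide +kernel

lemma compat_or_compat_neg_three {x y a b c : ZMod 23} (h : (three 1 : Shape (ZMod 23)).IsPoint x y a b c) :
    (three 1 : Shape (ZMod 23)).Compat ⟨22, 0, 5⟩ x a b c ∨
      (three 1 : Shape (ZMod 23)).Compat ⟨22, 0, 5⟩ x (-a) (-b) (-c) :=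
  h.search (P := fun x _ a b c => (three 1 : Shape (ZMod 23)).Compat ⟨22, 0, 5⟩ x a b c ∨
    (three 1 : Shape (ZMod 23)).Compat ⟨22, 0, 5⟩ x (-a) (-b) (-c)) (by decide +kernel)

theorem not_odd_of_compat_three {x y y' a b c u d e f : ℤ} {k : ℕ}
    (h : (three 1 : Shape ℤ).IsPoint x y a b c)
    (h' : (three 1 : Shape ℤ).IsPoint (x + 2 ^ k * u) y' (a + 2 ^ k * d) (b + 2 ^ k * e)
      (c + 2 ^ k * f))
    (hc : (three 1 : Shape (ZMod 23)).Compat ⟨22, 0, 5⟩ x a b c)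
    (hc' : (three 1 : Shape (ZMod 23)).Compat ⟨22, 0, 5⟩ ((x + 2 ^ k * u : ℤ) : ZMod 23)
      ((a + 2 ^ k * d : ℤ) : ZMod 23) ((b + 2 ^ k * e : ℤ) : ZMod 23)
      ((c + 2 ^ k * f : ℤ) : ZMod 23)) : ¬ Odd f := by
  intro hodd
  have hS : (three 1 : Shape ℤ).map (Int.castRingHom (ZMod 23)) = three 1 := by
    rw [map_three, _root_.map_one]
  refine not_independent (S := three 1) (δ' := ⟨0, 1, 0⟩) (m := 3) (by norm_num) (by decide +kernel)
    (norm_unitOfNorm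
      (⟨⟨41, -88, 32⟩, ⟨-36, 80, -28⟩⟩ : SqrtRing (three 1 : Shape ℤ).δ) (by decide +kernel))
    (norm_unitOfNorm
      (⟨⟨2017, -1608, 360⟩, ⟨-852, 680, -152⟩⟩ : SqrtRing (three 1 : Shape ℤ).δ) (by decide +kernel))
    (θ₁ := ⟨⟨10, -22, 8⟩, ⟨-9, 20, -7⟩⟩)
    (θ₂ := ⟨⟨504, -402, 90⟩, ⟨-213, 170, -38⟩⟩)
    (by decide +kernel) (by decide +kernel) (τ := ⟨22, 0, 5⟩) (by decide +kernel) (norm_phi_three h) (norm_phi_three h')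
    (by rw [hS]; exact hc) (by rw [hS]; exact hc') ?_
  intro r s t h0 h1 h2
  simp [form, three, scalar] at h0 h1 h2
  rw [← ZMod.intCast_eq_one_iff_odd] at hodd
  revert h0 h1 h2 hodd
  generalize (d : ZMod 2) = d
  generalize (e : ZMod 2) = e
  generalize (f : ZMod 2) = f
  revert r s t d e f
  decide +kernel

lemma compat_or_compat_neg_six {x y a b c : ZMod 23} (h : (three 2 : Shape (ZMod 23)).IsPoint x y a b c) :
    (three 2 : Shape (ZMod 23)).Compat ⟨5, 0, 21⟩ x a b c ∨
      (three 2 : Shape (ZMod 23)).Compat ⟨5, 0, 21⟩ x (-a) (-b) (-c) :=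
  h.search (P := fun x _ a b c => (three 2 : Shape (ZMod 23)).Compat ⟨5, 0, 21⟩ x a b c ∨
    (three 2 : Shape (ZMod 23)).Compat ⟨5, 0, 21⟩ x (-a) (-b) (-c)) (by decide +kernel)

lemma norm_six_fst : QuadraticAlgebra.norm
    (⟨⟨433, -960, 288⟩, ⟨252, -556, 156⟩⟩ : SqrtRing (three 2 : Shape ℤ).δ) = 1 := by
  decide +kernel

lemma norm_six_snd : QuadraticAlgebra.norm
    (⟨⟨184033, -146400, 32784⟩, ⟨-54924, 43692, -9784⟩⟩ : SqrtRing (three 2 : Shape ℤ).δ) = 1 := by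
  decide +kernel

theorem not_odd_of_compat_six {x y y' a b c u d e f : ℤ} {k : ℕ}
    (h : (three 2 : Shape ℤ).IsPoint x y a b c)
    (h' : (three 2 : Shape ℤ).IsPoint (x + 2 ^ k * u) y' (a + 2 ^ k * d) (b + 2 ^ k * e)
      (c + 2 ^ k * f))
    (hc : (three 2 : Shape (ZMod 23)).Compat ⟨5, 0, 21⟩ x a b c)
    (hc' : (three 2 : Shape (ZMod 23)).Compat ⟨5, 0, 21⟩ ((x + 2 ^ k * u : ℤ) : ZMod 23)
      ((a + 2 ^ k * d : ℤ) : ZMod 23) ((b + 2 ^ k * e : ℤ) : ZMod 23)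
      ((c + 2 ^ k * f : ℤ) : ZMod 23)) : ¬ Odd (d + e + f) := by
  intro hodd
  have hS : (three 2 : Shape ℤ).map (Int.castRingHom (ZMod 23)) = three 2 := by
    rw [map_three, map_ofNat]
  refine not_independent (S := three 2) (δ' := ⟨0, 1, 0⟩) (m := 6) (by norm_num) (by decide +kernel)
    (norm_unitOfNorm
      (⟨⟨433, -960, 288⟩, ⟨252, -556, 156⟩⟩ : SqrtRing (three 2 : Shape ℤ).δ) norm_six_fst)
    (norm_unitOfNorm
      (⟨⟨184033, -146400, 32784⟩, ⟨-54924, 43692, -9784⟩⟩ : SqrtRing (three 2 : Shape ℤ).δ) norm_six_snd)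
    (θ₁ := ⟨⟨108, -240, 72⟩, ⟨63, -139, 39⟩⟩)
    (θ₂ := ⟨⟨46008, -36600, 8196⟩, ⟨-13731, 10923, -2446⟩⟩)
    (by decide +kernel) (by decide +kernel) (τ := ⟨5, 0, 21⟩) (by decide +kernel) (norm_phi_three h) (norm_phi_three h')
    (by rw [hS]; exact hc) (by rw [hS]; exact hc') ?_
  intro r s t h0 h1 h2
  simp [form, three, scalar] at h0 h1 h2
  rw [← ZMod.intCast_eq_one_iff_odd] at hodd
  push_cast at hodd
  revert h0 h1 h2 hodd
  generalize (d : ZMod 2) = d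
  generalize (e : ZMod 2) = e
  generalize (f : ZMod 2) = f
  revert r s t d e f
  decide +kernel

end Shape

end CubicRing

lemma Int.exists_two_pow_mul {ι : Type*} {D : ι → ℤ} (h : D ≠ 0) :
    ∃ (k : ℕ) (E : ι → ℤ), (∀ i, D i = 2 ^ k * E i) ∧ ¬ ∀ i, 2 ∣ E i := by
  obtain ⟨j, hj⟩ := Function.ne_iff.1 h
  induction hn : (D j).natAbs using Nat.strong_induction_on generalizing D with
  | _ n ih =>
    by_cases hD : ∀ i, 2 ∣ D i
    · choose E hE using hD
      have hEj : E j ≠ 0 := by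
        intro h0
        exact hj (by rw [hE, h0]; rfl)
      have hlt : (E j).natAbs < n := by
        have := hE j
        omega
      obtain ⟨k, F, hF, hF'⟩ := ih _ hlt (fun h0 => hEj (congrFun h0 j)) hEj rfl
      exact ⟨k + 1, F, fun i => by rw [hE, hF, pow_succ]; ring, hF'⟩
    · exact ⟨0, D, fun i => by simp, hD⟩

lemma Int.exists_two_pow_succ_mul {ι : Type*} {D : ι → ℤ} (h : D ≠ 0) (h2 : ∀ i, 2 ∣ D i) :
    ∃ (k : ℕ) (E : ι → ℤ), (∀ i, D i = 2 ^ (k + 1) * E i) ∧ ¬ ∀ i, 2 ∣ E i := by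
  obtain ⟨k, E, hE, hE'⟩ := Int.exists_two_pow_mul h
  cases k with
  | zero => exact absurd (fun i => by have := h2 i; rwa [hE, pow_zero, one_mul] at this) hE'
  | succ k => exact ⟨k, E, hE, hE'⟩

namespace CubicRing

namespace Shape

variable {S : Shape ℤ}

/-- Two points of an odd covering that agree modulo `2 ^ (k + 1)` and whose last coordinate is
odd differ by `2 ^ (k + 1)` times a vector with odd last coordinate. -/
lemma IsPoint.odd_of_close (hα : S.α = 1) (hm : Odd S.m) {x y a b c u v d e f : ℤ} {k : ℕ}
    (h : S.IsPoint x y a b c) (hc : Odd c)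
    (h' : S.IsPoint (x + 2 ^ (k + 1) * u) (y + 2 ^ (k + 1) * v) (a + 2 ^ (k + 1) * d)
      (b + 2 ^ (k + 1) * e) (c + 2 ^ (k + 1) * f))
    (hne : ¬ (2 ∣ u ∧ 2 ∣ v ∧ 2 ∣ d ∧ 2 ∣ e ∧ 2 ∣ f)) : Odd f := by
  have hK : (2 * 2 ^ k : ℤ) ≠ 0 := by positivity
  have r11 := h.r11
  have r12 := h.r12
  have r13 := h.r13
  have r22 := h.r22
  have r23 := h.r23
  have r33 := h.r33
  have r11' := h'.r11
  have r12' := h'.r12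
  have r13' := h'.r13
  have r22' := h'.r22
  have r23' := h'.r23
  have r33' := h'.r33
  rw [hα] at r11 r12 r13 r22 r23 r33 r11' r12' r13' r22' r23' r33'
  rw [show (2 : ℤ) ^ (k + 1) = 2 * 2 ^ k by ring] at r11' r12' r13' r22' r23' r33'
  generalize (2 : ℤ) ^ k = K at *
  have e11 : x * u + x * v + u * (x - y + 1) = 2 * (S.m * (a * d + K * d ^ 2) + x * v - K * u * (u - v)) := by
    apply mul_left_cancel₀ hK
    linear_combination -r11' + r11
  have e22 : u = 2 * (-S.n * (b * e + K * e ^ 2) + x * u + K * u ^ 2 + y * v + K * v ^ 2) := by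
    apply mul_left_cancel₀ hK
    linear_combination r22' - r22
  have e33 : v - x * v - y * u = 2 * (-S.m * (c * f + K * f ^ 2) - x * u - K * u ^ 2 + K * u * v +
      3 * y * v + 3 * K * v ^ 2) := by
    apply mul_left_cancel₀ hK
    linear_combination r33' - r33
  have e12 : a * e + b * d - x * v - y * u = 2 * (K * u * v - K * d * e) := by
    apply mul_left_cancel₀ hK
    linear_combination r12' - r12
  have e13 : S.m * (a * f + c * d) - v * (x - y + 1) - y * (u - v) =
      2 * (K * v * (u - v) - S.m * K * d * f) := by
    apply mul_left_cancel₀ hK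
    linear_combination r13' - r13
  have e23 : b * f + c * e = 2 * (y * v + K * v ^ 2 - K * e * f) := by
    apply mul_left_cancel₀ hK
    linear_combination r23' - r23
  have E11 := (even_iff_two_dvd.2 ⟨_, e11⟩)
  have E22 := (even_iff_two_dvd.2 ⟨_, e22⟩)
  have E33 := (even_iff_two_dvd.2 ⟨_, e33⟩)
  have E12 := (even_iff_two_dvd.2 ⟨_, e12⟩)
  have E13 := (even_iff_two_dvd.2 ⟨_, e13⟩)
  have E23 := (even_iff_two_dvd.2 ⟨_, e23⟩)
  rw [← Int.not_even_iff_odd] at hm hc ⊢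
  simp only [← even_iff_two_dvd] at hne
  simp only [Int.even_add, Int.even_sub, Int.even_mul] at E11 E33 E12 E13 E23
  grind

/-- The relations satisfied by the points of an even covering after removing common factors. -/
structure IsHalfPoint (m n x y a b c : ℤ) : Prop where
  r11 : m * a ^ 2 = (2 * x + 1) * (1 + x - y)
  r12 : a * b = (2 * x + 1) * y
  r13 : m * (a * c) = y * (1 + x - y)
  r22 : n * b ^ 2 = x * (2 * x + 1) + 2 * y ^ 2
  r23 : b * c = y ^ 2
  r33 : 2 * m * c ^ 2 = -x ^ 2 - x + x * y + 3 * y ^ 2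

lemma IsHalfPoint.even_of_close {m n x y a b c u v d e f : ℤ} {k : ℕ} (hm : Odd m)
    (h : IsHalfPoint m n x y a b c)
    (h' : IsHalfPoint m n (x + 2 ^ (k + 1) * u) (y + 2 ^ (k + 1) * v) (a + 2 ^ (k + 1) * d)
      (b + 2 ^ (k + 1) * e) (c + 2 ^ (k + 1) * f)) :
    Even u ∧ Even v ∧ Even (a * e + b * d) ∧ Even (a * f + c * d) ∧ Even (b * f + c * e) := by
  have hK : (2 * 2 ^ k : ℤ) ≠ 0 := by positivity
  have r11 := h.r11
  have r12 := h.r12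
  have r13 := h.r13
  have r22 := h.r22
  have r23 := h.r23
  have r11' := h'.r11
  have r12' := h'.r12
  have r13' := h'.r13
  have r22' := h'.r22
  have r23' := h'.r23
  rw [show (2 : ℤ) ^ (k + 1) = 2 * 2 ^ k by ring] at r11' r12' r13' r22' r23'
  generalize (2 : ℤ) ^ k = K at *
  have e11 : u - v = 2 * (m * (a * d + K * d ^ 2) - u * (1 + x - y) - x * (u - v) -
      2 * K * u * (u - v)) := by
    apply mul_left_cancel₀ hK
    linear_combination -r11' + r11
  have e22 : u = 2 * (n * (b * e + K * e ^ 2) - 2 * x * u - 2 * K * u ^ 2 - 2 * y * v -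
      2 * K * v ^ 2) := by
    apply mul_left_cancel₀ hK
    linear_combination -r22' + r22
  have e12 : a * e + b * d - v = 2 * (x * v + y * u + 2 * K * u * v - K * d * e) := by
    apply mul_left_cancel₀ hK
    linear_combination r12' - r12
  have e13 : m * (a * f + c * d) - v * (1 + x - y) - y * (u - v) =
      2 * (K * v * (u - v) - m * K * d * f) := by
    apply mul_left_cancel₀ hK
    linear_combination r13' - r13
  have e23 : b * f + c * e = 2 * (y * v + K * v ^ 2 - K * e * f) := by
    apply mul_left_cancel₀ hK
    linear_combination r23' - r23
  have E11 := (even_iff_two_dvd.2 ⟨_, e11⟩)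
  have E22 := (even_iff_two_dvd.2 ⟨_, e22⟩)
  have E12 := (even_iff_two_dvd.2 ⟨_, e12⟩)
  have E13 := (even_iff_two_dvd.2 ⟨_, e13⟩)
  have E23 := (even_iff_two_dvd.2 ⟨_, e23⟩)
  rw [← Int.not_even_iff_odd] at hm
  simp only [Int.even_add, Int.even_sub, Int.even_mul] at E11 E12 E13 E23 ⊢
  grind

lemma two_mul_intCast_eq_zero {z : ℤ} : (2 * (z : ZMod 4) = 0) ↔ Even z := by
  have := ZMod.intCast_zmod_eq_zero_iff_dvd (2 * z) 4
  push_cast at this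
  rw [this, even_iff_two_dvd]
  omega

set_option synthInstance.maxSize 1000 in
lemma IsPoint.parity {x y a b c : ℤ}
    (hS : S.map (Int.castRingHom (ZMod 4)) = one 1 ∨ S.map (Int.castRingHom (ZMod 4)) = three 1)
    (h : S.IsPoint x y a b c) : ¬ Even c ∧ ((Even x ∧ Even y ∧ Even a ∧ Even b) ∨
      (Even x ∧ ¬ Even y ∧ Even a ∧ ¬ Even b) ∨ (¬ Even x ∧ ¬ Even y ∧ ¬ Even a ∧ ¬ Even b)) := by
  have h4 := h.map (Int.castRingHom (ZMod 4))
  simp only [← two_mul_intCast_eq_zero]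
  rcases hS with hS | hS <;> rw [hS] at h4
  all_goals
    exact h4.search (P := fun x y a b c : ZMod 4 => ¬ 2 * c = 0 ∧
      ((2 * x = 0 ∧ 2 * y = 0 ∧ 2 * a = 0 ∧ 2 * b = 0) ∨
      (2 * x = 0 ∧ ¬ 2 * y = 0 ∧ 2 * a = 0 ∧ ¬ 2 * b = 0) ∨
      (¬ 2 * x = 0 ∧ ¬ 2 * y = 0 ∧ ¬ 2 * a = 0 ∧ ¬ 2 * b = 0))) (by decide +kernel)

set_option synthInstance.maxSize 1000 in
lemma IsPoint.exists_isHalfPoint {x y a b c : ℤ} (hα : S.α = 2)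
    (hS : S.map (Int.castRingHom (ZMod 4)) = one 2 ∨ S.map (Int.castRingHom (ZMod 4)) = three 2)
    (h : S.IsPoint x y a b c) :
    ∃ X Y C, x = 2 * X + 1 ∧ y = 2 * Y ∧ c = 2 * C ∧ IsHalfPoint S.m S.n X Y a b C := by
  have h4 := h.map (Int.castRingHom (ZMod 4))
  have key : ¬ Even x ∧ Even y ∧ Even c := by
    simp only [← two_mul_intCast_eq_zero]
    rcases hS with hS | hS <;> rw [hS] at h4
    all_goals
      exact h4.search (P := fun x y _ _ c : ZMod 4 => ¬ 2 * x = 0 ∧ 2 * y = 0 ∧ 2 * c = 0)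
        (by decide +kernel)
  obtain ⟨hx, hy, hc⟩ := key
  rw [Int.not_even_iff_odd] at hx
  rw [even_iff_two_dvd] at hy hc
  obtain ⟨X, rfl⟩ := hx
  obtain ⟨Y, rfl⟩ := hy
  obtain ⟨C, rfl⟩ := hc
  have r11 := h.r11
  have r12 := h.r12
  have r13 := h.r13
  have r22 := h.r22
  have r23 := h.r23
  have r33 := h.r33
  rw [hα] at r11 r12 r13 r22 r23 r33
  have h2 : (2 : ℤ) ≠ 0 := by norm_num
  have h4 : (4 : ℤ) ≠ 0 := by norm_num
  refine ⟨X, Y, C, rfl, rfl, rfl, ?_, ?_, ?_, ?_, ?_, ?_⟩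
  · exact mul_left_cancel₀ h2 (by linear_combination r11)
  · exact mul_left_cancel₀ h2 (by linear_combination r12)
  · exact mul_left_cancel₀ h4 (by linear_combination r13)
  · exact mul_left_cancel₀ h2 (by linear_combination r22)
  · exact mul_left_cancel₀ h4 (by linear_combination r23)
  · exact mul_left_cancel₀ h4 (by linear_combination r33)

lemma IsHalfPoint.parity {m n x y a b c : ℤ} (hm : Odd m) (hn : Odd n)
    (h : IsHalfPoint m n x y a b c) :
    (Even x ∧ Even y ∧ ¬ Even a ∧ Even b ∧ Even c) ∨
      (¬ Even x ∧ Even y ∧ Even a ∧ ¬ Even b ∧ Even c) ∨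
      (¬ Even x ∧ ¬ Even y ∧ ¬ Even a ∧ ¬ Even b ∧ ¬ Even c) := by
  have r11 := congrArg Even h.r11
  have r12 := congrArg Even h.r12
  have r13 := congrArg Even h.r13
  have r22 := congrArg Even h.r22
  have r23 := congrArg Even h.r23
  rw [← Int.not_even_iff_odd] at hm hn
  simp [Int.even_add, Int.even_sub, Int.even_mul, Int.even_pow] at r11 r12 r13 r22 r23
  grind

end Shape

end CubicRing

namespace CubicRing

namespace Shape

variable {S : Shape ℤ}

/-- Of two opposite points one satisfies the compatibility condition. -/
lemma IsPoint.exists_compat {S' : Shape (ZMod 23)} {τ : CubicRing (ZMod 23)} {x y a b c : ℤ}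
    (hS : S.map (Int.castRingHom (ZMod 23)) = S')
    (H : ∀ x y a b c, S'.IsPoint x y a b c → S'.Compat τ x a b c ∨ S'.Compat τ x (-a) (-b) (-c))
    (h : S.IsPoint x y a b c) :
    ∃ a b c : ℤ, S.IsPoint x y a b c ∧ S'.Compat τ x a b c := by
  have h' := h.map (Int.castRingHom (ZMod 23))
  rw [hS] at h'
  rcases H _ _ _ _ _ h' with hc | hc
  · exact ⟨a, b, c, h, hc⟩
  · exact ⟨-a, -b, -c, h.neg, by push_cast; exact hc⟩

lemma IsPoint.exists_odd_of_close (hα : S.α = 1) (hm : Odd S.m) {x y a b c x₁ y₁ a₁ b₁ c₁ : ℤ}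
    (h : S.IsPoint x y a b c) (hc : Odd c) (h₁ : S.IsPoint x₁ y₁ a₁ b₁ c₁) (hx₁ : 2 ∣ x₁ - x)
    (hy₁ : 2 ∣ y₁ - y) (ha₁ : 2 ∣ a₁ - a) (hb₁ : 2 ∣ b₁ - b) (hc₁ : 2 ∣ c₁ - c) (hne : y₁ ≠ y) :
    ∃ (k : ℕ) (u d e f : ℤ), x₁ = x + 2 ^ k * u ∧ a₁ = a + 2 ^ k * d ∧ b₁ = b + 2 ^ k * e ∧
      c₁ = c + 2 ^ k * f ∧ Odd f := by
  obtain ⟨k, E, hE, hE'⟩ := Int.exists_two_pow_succ_mul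
    (D := ![x₁ - x, y₁ - y, a₁ - a, b₁ - b, c₁ - c])
    (fun h0 => hne (sub_eq_zero.1 (congrFun h0 1)))
    (by intro i; fin_cases i <;> assumption)
  have h0 := hE 0
  have h1 := hE 1
  have h2 := hE 2
  have h3 := hE 3
  have h4 := hE 4
  simp only [Matrix.cons_val, sub_eq_iff_eq_add'] at h0 h1 h2 h3 h4
  subst h0 h1 h2 h3 h4
  refine ⟨k + 1, E 0, E 2, E 3, E 4, rfl, rfl, rfl, rfl, h.odd_of_close hα hm hc h₁ ?_⟩
  intro hall
  refine hE' fun i => ?_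
  fin_cases i
  exacts [hall.1, hall.2.1, hall.2.2.1, hall.2.2.2.1, hall.2.2.2.2]

lemma IsHalfPoint.exists_even_of_close {m n x y a b c x₁ y₁ a₁ b₁ c₁ : ℤ} (hm : Odd m)
    (h : IsHalfPoint m n x y a b c) (h₁ : IsHalfPoint m n x₁ y₁ a₁ b₁ c₁) (hx₁ : 2 ∣ x₁ - x)
    (hy₁ : 2 ∣ y₁ - y) (ha₁ : 2 ∣ a₁ - a) (hb₁ : 2 ∣ b₁ - b) (hc₁ : 2 ∣ c₁ - c) (hne : y₁ ≠ y) :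
    ∃ (k : ℕ) (u d e f : ℤ), x₁ = x + 2 ^ k * u ∧ a₁ = a + 2 ^ k * d ∧ b₁ = b + 2 ^ k * e ∧
      c₁ = c + 2 ^ k * f ∧ Even (a * e + b * d) ∧ Even (a * f + c * d) ∧ Even (b * f + c * e) ∧
      ¬ (Even d ∧ Even e ∧ Even f) := by
  obtain ⟨k, E, hE, hE'⟩ := Int.exists_two_pow_succ_mul
    (D := ![x₁ - x, y₁ - y, a₁ - a, b₁ - b, c₁ - c])
    (fun h0 => hne (sub_eq_zero.1 (congrFun h0 1)))
    (by intro i; fin_cases i <;> assumption)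
  have h0 := hE 0
  have h1 := hE 1
  have h2 := hE 2
  have h3 := hE 3
  have h4 := hE 4
  simp only [Matrix.cons_val, sub_eq_iff_eq_add'] at h0 h1 h2 h3 h4
  subst h0 h1 h2 h3 h4
  obtain ⟨hu, hv, H⟩ := h.even_of_close hm h₁
  refine ⟨k + 1, E 0, E 2, E 3, E 4, rfl, rfl, rfl, rfl, H.1, H.2.1, H.2.2, ?_⟩
  simp only [even_iff_two_dvd] at hu hv ⊢
  rintro ⟨hd, he, hf⟩
  refine hE' fun i => ?_
  fin_cases i
  exacts [hu, hv, hd, he, hf]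

theorem IsPoint.lt_three_of_one {x y a b c : ℤ} (h : (one 1 : Shape ℤ).IsPoint x y a b c) :
    y < 3 := by
  by_contra! hy
  obtain ⟨a, b, c, h, hc⟩ := h.exists_compat (S' := one 1) (by rw [map_one, _root_.map_one])
    fun _ _ _ _ _ => compat_or_compat_neg_one
  obtain ⟨hc1, hpar⟩ := h.parity (.inl (by rw [map_one, _root_.map_one]))
  simp only [Int.even_iff] at hc1 hpar
  rcases hpar with hp | hp | hp
  · have h₀ : (one 1 : Shape ℤ).IsPoint 0 0 0 0 1 := by constructor <;> decide
    obtain ⟨k, u, d, e, f, rfl, rfl, rfl, rfl, hf⟩ := h₀.exists_odd_of_close rfl (by decide)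
      (by decide) h (by omega) (by omega) (by omega) (by omega) (by omega) (by omega)
    exact not_odd_of_compat_one h₀ h (by decide +kernel) hc hf
  · have h₀ : (one 1 : Shape ℤ).IsPoint 2 1 (-2) (-1) (-1) := by constructor <;> decide
    obtain ⟨k, u, d, e, f, rfl, rfl, rfl, rfl, hf⟩ := h₀.exists_odd_of_close rfl (by decide)
      (by decide) h (by omega) (by omega) (by omega) (by omega) (by omega) (by omega)
    exact not_odd_of_compat_one h₀ h (by decide +kernel) hc hf
  · have h₀ : (one 1 : Shape ℤ).IsPoint (-1) 1 (-1) 1 1 := by constructor <;> decide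
    obtain ⟨k, u, d, e, f, rfl, rfl, rfl, rfl, hf⟩ := h₀.exists_odd_of_close rfl (by decide)
      (by decide) h (by omega) (by omega) (by omega) (by omega) (by omega) (by omega)
    exact not_odd_of_compat_one h₀ h (by decide +kernel) hc hf

theorem IsPoint.lt_three_of_three {x y a b c : ℤ} (h : (three 1 : Shape ℤ).IsPoint x y a b c) :
    y < 3 := by
  by_contra! hy
  obtain ⟨a, b, c, h, hc⟩ := h.exists_compat (S' := three 1) (by rw [map_three, _root_.map_one])
    fun _ _ _ _ _ => compat_or_compat_neg_three
  obtain ⟨hc1, hpar⟩ := h.parity (.inr (by rw [map_three, _root_.map_one]))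
  simp only [Int.even_iff] at hc1 hpar
  rcases hpar with hp | hp | hp
  · have h₀ : (three 1 : Shape ℤ).IsPoint 4 2 2 4 1 := by constructor <;> decide
    obtain ⟨k, u, d, e, f, rfl, rfl, rfl, rfl, hf⟩ := h₀.exists_odd_of_close rfl (by decide)
      (by decide) h (by omega) (by omega) (by omega) (by omega) (by omega) (by omega)
    exact not_odd_of_compat_three h₀ h (by decide +kernel) hc hf
  · have h₀ : (three 1 : Shape ℤ).IsPoint 0 1 0 (-1) (-1) := by constructor <;> decide
    obtain ⟨k, u, d, e, f, rfl, rfl, rfl, rfl, hf⟩ := h₀.exists_odd_of_close rfl (by decide)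
      (by decide) h (by omega) (by omega) (by omega) (by omega) (by omega) (by omega)
    exact not_odd_of_compat_three h₀ h (by decide +kernel) hc hf
  · have h₀ : (three 1 : Shape ℤ).IsPoint 1 (-1) 1 (-1) (-1) := by constructor <;> decide
    obtain ⟨k, u, d, e, f, rfl, rfl, rfl, rfl, hf⟩ := h₀.exists_odd_of_close rfl (by decide)
      (by decide) h (by omega) (by omega) (by omega) (by omega) (by omega) (by omega)
    exact not_odd_of_compat_three h₀ h (by decide +kernel) hc hf

theorem IsPoint.lt_three_of_two {x y a b c : ℤ} (h : (one 2 : Shape ℤ).IsPoint x y a b c) :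
    y < 3 := by
  by_contra! hy
  obtain ⟨a, b, c, h, hc⟩ := h.exists_compat (S' := one 2) (by rw [map_one, map_ofNat])
    fun _ _ _ _ _ => compat_or_compat_neg_two
  obtain ⟨x, y, c, rfl, rfl, rfl, hh⟩ := h.exists_isHalfPoint rfl
    (.inl (by rw [map_one, map_ofNat]))
  have hpar := hh.parity (by decide) (by decide)
  simp only [Int.even_iff] at hpar
  rcases hpar with hp | hp | hp
  · have h₀ : (one 2 : Shape ℤ).IsPoint 1 0 1 0 0 := by constructor <;> decide
    have hh₀ : IsHalfPoint (one 2 : Shape ℤ).m (one 2 : Shape ℤ).n 0 0 1 0 0 := by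
      constructor <;> decide
    obtain ⟨k, u, d, e, f, rfl, rfl, rfl, rfl, h12, h13, h23, hne⟩ :=
      hh₀.exists_even_of_close (by decide) hh (by omega) (by omega) (by omega) (by omega)
        (by omega) (by omega)
    have hx : 2 * (0 + 2 ^ k * u) + 1 = 1 + 2 ^ k * (2 * u) := by ring
    have hz : 2 * (0 + 2 ^ k * f) = 0 + 2 ^ k * (2 * f) := by ring
    rw [hx, hz] at h hc
    refine not_odd_of_compat_two h₀ h (by decide +kernel) hc ?_
    simp only [Int.even_iff, Int.odd_iff] at *
    omega
  · have h₀ : (one 2 : Shape ℤ).IsPoint 1 0 1 0 0 := by constructor <;> decide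
    obtain ⟨u, hu⟩ : ∃ u, 2 * x + 1 = 1 + 2 ^ 0 * u := ⟨2 * x + 1 - 1, by ring⟩
    obtain ⟨d, rfl⟩ : ∃ d, a = 1 + 2 ^ 0 * d := ⟨a - 1, by ring⟩
    obtain ⟨e, rfl⟩ : ∃ e, b = 0 + 2 ^ 0 * e := ⟨b - 0, by ring⟩
    obtain ⟨f, hf⟩ : ∃ f, 2 * c = 0 + 2 ^ 0 * f := ⟨2 * c - 0, by ring⟩
    rw [hu, hf] at h hc
    refine not_odd_of_compat_two h₀ h (by decide +kernel) hc ?_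
    rw [Int.odd_iff]
    omega
  · have h₀ : (one 2 : Shape ℤ).IsPoint (-1) 2 1 (-1) (-2) := by constructor <;> decide
    have hh₀ : IsHalfPoint (one 2 : Shape ℤ).m (one 2 : Shape ℤ).n (-1) 1 1 (-1) (-1) := by
      constructor <;> decide
    obtain ⟨k, u, d, e, f, rfl, rfl, rfl, rfl, h12, h13, h23, hne⟩ :=
      hh₀.exists_even_of_close (by decide) hh (by omega) (by omega) (by omega) (by omega)
        (by omega) (by omega)
    have hx : 2 * (-1 + 2 ^ k * u) + 1 = -1 + 2 ^ k * (2 * u) := by ring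
    have hz : 2 * (-1 + 2 ^ k * f) = -2 + 2 ^ k * (2 * f) := by ring
    rw [hx, hz] at h hc
    refine not_odd_of_compat_two h₀ h (by decide +kernel) hc ?_
    simp only [Int.even_iff, Int.odd_iff] at *
    omega

end Shape

end CubicRing

section CommGroup

variable {G : Type*} [CommGroup G]

lemma zpow_eq_zpow_of_pow_eq_one {g : G} {n : ℕ} (hg : g ^ n = 1) {a b : ℤ}
    (h : (n : ℤ) ∣ a - b) : g ^ a = g ^ b := by
  obtain ⟨m, hm⟩ := h
  rw [show a = n * m + b by omega, zpow_add, zpow_mul, zpow_natCast, hg, one_zpow, one_mul]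

lemma three_dvd_of_zpow_mul_zpow_eq_one {g h : G} (hg : g ^ 3 = 1) (hh : h ^ 3 = 1)
    (ind : ∀ i j : Fin 3, g ^ (i : ℕ) * h ^ (j : ℕ) = 1 → i = 0 ∧ j = 0) {a b : ℤ}
    (hab : g ^ a * h ^ b = 1) : 3 ∣ a ∧ 3 ∣ b := by
  have ha : g ^ a = g ^ (a % 3).toNat := by
    rw [← zpow_natCast]
    exact zpow_eq_zpow_of_pow_eq_one hg (by omega)
  have hb : h ^ b = h ^ (b % 3).toNat := by
    rw [← zpow_natCast]
    exact zpow_eq_zpow_of_pow_eq_one hh (by omega)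
  rw [ha, hb] at hab
  have := ind ⟨(a % 3).toNat, by omega⟩ ⟨(b % 3).toNat, by omega⟩ hab
  simp only [Fin.ext_iff, Fin.val_zero] at this
  omega

lemma pow_eq_one_of_zpow_eq_one {g : G} {c : ℤ} (hc : g ^ c = 1) (hg : g ^ 840 = 1)
    (h2 : ¬ 2 ∣ c) (h3 : ¬ 3 ∣ c) : g ^ 35 = 1 := by
  have h : (24 : ℤ) ∣ c * c - 1 := by
    refine Int.dvd_of_emod_eq_zero ?_
    have : c % 24 = 1 ∨ c % 24 = 5 ∨ c % 24 = 7 ∨ c % 24 = 11 ∨ c % 24 = 13 ∨ c % 24 = 17 ∨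
        c % 24 = 19 ∨ c % 24 = 23 := by omega
    rcases this with h | h | h | h | h | h | h | h <;> simp [Int.sub_emod, Int.mul_emod, h]
  have h35 : g ^ (35 * (c * c)) = g ^ (35 : ℤ) :=
    zpow_eq_zpow_of_pow_eq_one hg (by omega)
  rw [show 35 * (c * c) = c * (35 * c) by ring, zpow_mul, hc, one_zpow] at h35
  exact_mod_cast h35.symm

end CommGroup

namespace SqrtRing

/-- Base change. -/
def map {R R' : Type*} [CommRing R] [CommRing R'] (f : R →+* R') {δ : CubicRing R}
    {δ' : CubicRing R'} (h : CubicRing.map f δ = δ') : SqrtRing δ →+* SqrtRing δ' where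
  toFun z := ⟨CubicRing.map f z.re, CubicRing.map f z.im⟩
  map_one' := by ext1 <;> simp [QuadraticAlgebra.re_one, QuadraticAlgebra.im_one]
  map_zero' := by ext1 <;> simp
  map_mul' z w := by subst h; ext1 <;> simp
  map_add' z w := by ext1 <;> simp

lemma eq_zero_of_mul_one_add_two_mul {δ : CubicRing ℤ} {t s : SqrtRing δ}
    (h : t * (1 + 2 * s) = 0) : t = 0 := by
  have key (k : ℕ) : ∃ v, t = ((2 ^ k : ℤ) : SqrtRing δ) * v := by
    induction k with
    | zero => exact ⟨t, by simp⟩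
    | succ k ih =>
      obtain ⟨v, hv⟩ := ih
      refine ⟨-(v * s), ?_⟩
      push_cast at hv ⊢
      linear_combination h - 2 * s * hv
  have zero {z : ℤ} (hz : ∀ k : ℕ, 2 ^ k ∣ z) : z = 0 := by
    by_contra h0
    have h3 := Nat.le_of_dvd (Int.natAbs_pos.2 h0) (Int.natAbs_dvd_natAbs.2 (hz z.natAbs))
    rw [Int.natAbs_pow] at h3
    exact absurd (Nat.lt_two_pow_self (n := z.natAbs)) (not_lt.2 h3)
  ext
  all_goals
    refine zero fun k => ?_
    obtain ⟨v, hv⟩ := key k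
    rw [hv]
    generalize (2 : ℤ) ^ k = K
    simp

lemma eq_one_of_sq_eq_one {δ : CubicRing ℤ} {w : (SqrtRing δ)ˣ} {t : SqrtRing δ}
    (hw : (w : SqrtRing δ) = 1 + 4 * t) (h : w ^ 2 = 1) : w = 1 := by
  have h1 := congrArg Units.val h
  rw [Units.val_pow_eq_pow_val, hw, Units.val_one] at h1
  have : t = 0 := by
    refine eq_zero_of_mul_one_add_two_mul (s := t) ?_
    refine nsmul_right_injective (n := 8) (by norm_num) ?_
    simp only [nsmul_eq_mul]
    push_cast
    linear_combination h1
  ext1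
  rw [hw, this, mul_zero, add_zero, Units.val_one]

lemma eq_one_of_pow_three_eq_one {δ : CubicRing ℤ} {w : (SqrtRing δ)ˣ} {t : SqrtRing δ}
    (hw : (w : SqrtRing δ) = 1 + 4 * t) (h : w ^ 3 = 1) : w = 1 := by
  have h1 := congrArg Units.val h
  rw [Units.val_pow_eq_pow_val, hw, Units.val_one] at h1
  have : t = 0 := by
    refine eq_zero_of_mul_one_add_two_mul (s := 1 + 6 * t + 8 * t ^ 2) ?_
    refine nsmul_right_injective (n := 4) (by norm_num) ?_
    simp only [nsmul_eq_mul]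
    push_cast
    linear_combination h1
  ext1
  rw [hw, this, mul_zero, add_zero, Units.val_one]

/-- Three units congruent to `1` modulo `4` satisfy a multiplicative relation that is primitive
at `2` and at `3`. -/
theorem exists_primitive_zpow_relation {δ δ' : CubicRing ℤ} {m : ℤ} (hm : m ≠ 0) (hδ : δ * δ' = m)
    {u : Fin 3 → (SqrtRing δ)ˣ} (hu : ∀ i, QuadraticAlgebra.norm (u i : SqrtRing δ) = 1)
    {θ : Fin 3 → SqrtRing δ} (hθ : ∀ i, (u i : SqrtRing δ) = 1 + 4 * θ i) :
    ∃ a : Fin 3 → ℤ, (¬ ∀ i, 2 ∣ a i) ∧ (¬ ∀ i, 3 ∣ a i) ∧ ∏ i, u i ^ a i = 1 := by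
  have cong (a : Fin 3 → ℤ) : ∃ t, ((∏ i, u i ^ a i : (SqrtRing δ)ˣ) : SqrtRing δ) = 1 + 4 * t := by
    choose w hw using fun i => Units.exists_zpow_eq (hθ i) (a i)
    rw [Fin.prod_univ_three]
    simp only [Units.val_mul, hw]
    set x := a 0 * θ 0 + 4 * θ 0 ^ 2 * w 0 with hx
    set y := a 1 * θ 1 + 4 * θ 1 ^ 2 * w 1 with hy
    set z := a 2 * θ 2 + 4 * θ 2 ^ 2 * w 2 with hz
    exact ⟨x + y + z + 4 * (x * y + y * z + z * x) + 16 * (x * y * z), by rw [hx, hy, hz]; ring⟩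
  obtain ⟨a, ha, h⟩ := exists_zpow_relation hm hδ u hu
  obtain ⟨j, hj⟩ := Function.ne_iff.1 ha
  induction hn : (a j).natAbs using Nat.strong_induction_on generalizing a with
  | _ n ih =>
    have descend (p : ℕ) (hp : 1 < p) (hpa : ∀ i, (p : ℤ) ∣ a i)
        (one : ∀ (w : (SqrtRing δ)ˣ) (t : SqrtRing δ), (w : SqrtRing δ) = 1 + 4 * t → w ^ p = 1 →
          w = 1) :
        ∃ a : Fin 3 → ℤ, (¬ ∀ i, 2 ∣ a i) ∧ (¬ ∀ i, 3 ∣ a i) ∧ ∏ i, u i ^ a i = 1 := by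
      choose b hb using hpa
      obtain ⟨t, ht⟩ := cong b
      have hbj : b j ≠ 0 := by
        intro h0
        exact hj (by rw [hb, h0, mul_zero]; rfl)
      refine ih (b j).natAbs ?_ b (fun h0 => hbj (congrFun h0 j)) (one _ t ht ?_) hbj rfl
      · rw [← hn, hb, Int.natAbs_mul, Int.natAbs_natCast]
        exact lt_mul_of_one_lt_left (Int.natAbs_pos.2 hbj) hp
      · rw [← Finset.prod_pow, ← h]
        refine Finset.prod_congr rfl fun i _ => ?_
        rw [hb i, mul_comm, zpow_mul, zpow_natCast]
    by_cases h2 : ∀ i, 2 ∣ a i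
    · exact descend 2 (by norm_num) h2 fun w t => eq_one_of_sq_eq_one
    by_cases h3 : ∀ i, 3 ∣ a i
    · exact descend 3 (by norm_num) h3 fun w t => eq_one_of_pow_three_eq_one
    exact ⟨a, h2, h3, h⟩

end SqrtRing

namespace CubicRing

namespace Shape

section Map

variable {R R' : Type*} [CommRing R] [CommRing R'] (f : R →+* R') {S : Shape R} {S' : Shape R'}

lemma map_phi (hS : S.map f = S') (h : CubicRing.map f S.δ = S'.δ) (x a b c : R) :
    SqrtRing.map f h (S.phi x a b c) = S'.phi (f x) (f a) (f b) (f c) := by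
  subst hS
  have h8 : CubicRing.map f 8 = 8 := map_ofNat _ 8
  have h19 : CubicRing.map f 19 = 19 := map_ofNat _ 19
  have h4 : CubicRing.map f 4 = 4 := map_ofNat _ 4
  ext1
  · simp [SqrtRing.map, phi, map_form, h8, h19, h]
  · simp [SqrtRing.map, phi, map_slope, h4]

lemma map_phi_mul_star (hS : S.map f = S') (h : CubicRing.map f S.δ = S'.δ)
    (x a b c x₀ a₀ b₀ c₀ : R) :
    SqrtRing.map f h (S.phi x a b c * star (S.phi x₀ a₀ b₀ c₀)) =
      S'.phi (f x) (f a) (f b) (f c) * star (S'.phi (f x₀) (f a₀) (f b₀) (f c₀)) := by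
  have hs (z : SqrtRing S.δ) : SqrtRing.map f h (star z) = star (SqrtRing.map f h z) := by
    ext1 <;> simp [SqrtRing.map]
  rw [_root_.map_mul, hs, map_phi f hS, map_phi f hS]

end Map

section Units

variable (R : Type*) [CommRing R]

/-- The first of two independent units of relative norm one. -/
def sixFst : SqrtRing (three 2 : Shape R).δ := ⟨⟨433, -960, 288⟩, ⟨252, -556, 156⟩⟩

/-- The second of two independent units of relative norm one. -/
def sixSnd : SqrtRing (three 2 : Shape R).δ :=
  ⟨⟨184033, -146400, 32784⟩, ⟨-54924, 43692, -9784⟩⟩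

variable {R}

/-- The product of the values of `phi` at a point and at the opposite of the point
`(-1, 0, 0, 1, 0)`. -/
def phiMulStar (x a b c : R) : SqrtRing (three 2 : Shape R).δ :=
  (three 2 : Shape R).phi x a b c * star ((three 2 : Shape R).phi (-1) 0 1 0)

end Units

section Orders

variable {S : Type*} [CommRing S] (G H Φ : S)

/-- Two elements generate a group of order nine, in characteristic three. -/
def OrdersThree : Prop :=
  (3 : S) = 0 ∧ G ^ 3 = 1 ∧ H ^ 3 = 1 ∧
    ∀ i j : Fin 3, G ^ (i : ℕ) * H ^ (j : ℕ) = 1 → i = 0 ∧ j = 0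

/-- The orders of two elements divide `30` and `15`, in characteristic `29`. -/
def OrdersTwentyNine : Prop :=
  (29 : S) = 0 ∧ G ^ 30 = 1 ∧ H ^ 15 = 1

/-- The two possible values of `phiMulStar` over a field with three elements. -/
def PhiThree : Prop := Φ = 1 ∨ Φ = G * H ^ 2

/-- The order of the element divides `840` but not `35`. -/
def HasEvenPart {M : Type*} [Monoid M] (z : M) : Prop :=
  (z ^ 5) ^ 7 ≠ 1 ∧ ((((z ^ 5) ^ 7) ^ 2) ^ 3) ^ 4 = 1

/-- Two products involving `Φ` have even order. -/
def PhiTwentyNine : Prop :=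
  HasEvenPart ((5 * Φ) ^ 5 * G ^ 15 * H ^ 0) ∧ HasEvenPart ((5 * Φ) ^ 5 * G ^ 25 * H ^ 5)

instance {M : Type*} [Monoid M] [DecidableEq M] (z : M) : Decidable (HasEvenPart z) :=
  inferInstanceAs (Decidable (_ ∧ _))

variable [DecidableEq S]

instance : Decidable (OrdersThree G H) := inferInstanceAs (Decidable (_ ∧ _))

instance : Decidable (OrdersTwentyNine G H) := inferInstanceAs (Decidable (_ ∧ _))

instance : Decidable (PhiThree G H Φ) := inferInstanceAs (Decidable (_ ∨ _))

instance : Decidable (PhiTwentyNine G H Φ) := inferInstanceAs (Decidable (_ ∧ _))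

end Orders

lemma ordersThree : OrdersThree (sixFst (ZMod 3)) (sixSnd (ZMod 3)) := by decide +kernel

lemma ordersTwentyNine : OrdersTwentyNine (sixFst (ZMod 29)) (sixSnd (ZMod 29)) := by decide +kernel

set_option synthInstance.maxSize 1000 in
lemma IsPoint.phiThree {x y a b c : ZMod 3}
    (h : (three 2 : Shape (ZMod 3)).IsPoint x y a b c) :
    PhiThree (sixFst (ZMod 3)) (sixSnd (ZMod 3)) (phiMulStar x a b c) :=
  h.search (P := fun x _ a b c => PhiThree (sixFst _) (sixSnd _) (phiMulStar x a b c)) (by decide +kernel)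

set_option synthInstance.maxSize 1000 in
lemma IsPoint.phiTwentyNine {x y a b c : ZMod 29}
    (h : (three 2 : Shape (ZMod 29)).IsPoint x y a b c) :
    PhiTwentyNine (sixFst (ZMod 29)) (sixSnd (ZMod 29)) (phiMulStar x a b c) :=
  h.search (P := fun x _ a b c =>
    PhiTwentyNine (sixFst _) (sixSnd _) (phiMulStar x a b c)) (by decide +kernel)

end Shape

end CubicRing

section CommGroup

variable {G : Type*} [CommGroup G]

lemma zpow_mul_pow_mul_pow_eq_one {g h e : G} (hg : g ^ 30 = 1) (hh : h ^ 15 = 1) {a b c : ℤ}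
    (rel : g ^ a * h ^ b * e ^ c = 1) {i j : ℕ} (hi : 30 ∣ 5 * a - i * c)
    (hj : 15 ∣ 5 * b - j * c) : (e ^ 5 * g ^ i * h ^ j) ^ c = 1 := by
  have h1 : g ^ (5 * a) = g ^ (i * c) := zpow_eq_zpow_of_pow_eq_one hg hi
  have h2 : h ^ (5 * b) = h ^ (j * c) := zpow_eq_zpow_of_pow_eq_one hh hj
  have h3 : (g ^ a * h ^ b * e ^ c) ^ (5 : ℤ) = 1 := by rw [rel, one_zpow]
  rw [mul_zpow, mul_zpow, ← zpow_mul, ← zpow_mul, ← zpow_mul, mul_comm a, mul_comm b, h1, h2] at h3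
  rw [mul_zpow, mul_zpow, ← zpow_natCast, ← zpow_natCast, ← zpow_natCast, ← zpow_mul, ← zpow_mul,
    ← zpow_mul, ← h3, Nat.cast_ofNat, mul_comm 5 c, mul_assoc, mul_comm (e ^ (c * 5))]

lemma dvd_or_dvd_of_zpow_mul_zpow_mul_zpow_eq_one {g h e : G} (hg : g ^ 3 = 1) (hh : h ^ 3 = 1)
    (ind : ∀ i j : Fin 3, g ^ (i : ℕ) * h ^ (j : ℕ) = 1 → i = 0 ∧ j = 0)
    (he : e = 1 ∨ e = g * h ^ 2) {r s t : ℤ} (rel : g ^ r * h ^ s * e ^ t = 1) :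
    3 ∣ r ∧ 3 ∣ s ∨ 3 ∣ r + t ∧ 3 ∣ s + 2 * t := by
  rcases he with rfl | rfl
  · rw [one_zpow, mul_one] at rel
    exact .inl (three_dvd_of_zpow_mul_zpow_eq_one hg hh ind rel)
  · refine .inr (three_dvd_of_zpow_mul_zpow_eq_one hg hh ind ?_)
    rw [← rel, mul_zpow, zpow_add, zpow_add, zpow_mul, zpow_ofNat]
    exact mul_mul_mul_comm _ _ _ _

end CommGroup

namespace CubicRing

namespace Shape

lemma HasEvenPart.zpow_ne_one {R : Type*} [CommMonoid R] {z : Rˣ} (hz : HasEvenPart (z : R))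
    {c : ℤ} (h2 : ¬ 2 ∣ c) (h3 : ¬ 3 ∣ c) : z ^ c ≠ 1 := by
  intro h
  obtain ⟨hz, hz'⟩ := hz
  simp only [← pow_mul] at hz hz'
  norm_num at hz hz'
  refine hz ?_
  have := pow_eq_one_of_zpow_eq_one h (by ext1; simpa using hz') h2 h3
  simpa using congrArg Units.val this

lemma HasEvenPart.not_dvd_and_not_dvd {R : Type*} [CommMonoid R] {g h e : Rˣ}
    (hg : g ^ 30 = 1) (hh : h ^ 15 = 1)
    (h1 : HasEvenPart ((e : R) ^ 5 * (g : R) ^ 15 * (h : R) ^ 0))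
    (h2 : HasEvenPart ((e : R) ^ 5 * (g : R) ^ 25 * (h : R) ^ 5)) {r s t : ℤ}
    (rel : g ^ r * h ^ s * e ^ t = 1) (hr : ¬ 2 ∣ r) (ht : ¬ 2 ∣ t) (ht' : ¬ 3 ∣ t) :
    ¬ (3 ∣ r ∧ 3 ∣ s) ∧ ¬ (3 ∣ r + t ∧ 3 ∣ s + 2 * t) := by
  have key (i j : ℕ) (hij : HasEvenPart ((e : R) ^ 5 * (g : R) ^ i * (h : R) ^ j))
      (hi : 30 ∣ 5 * r - i * t) (hj : 15 ∣ 5 * s - j * t) : False :=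
    HasEvenPart.zpow_ne_one (z := e ^ 5 * g ^ i * h ^ j) (by push_cast; exact hij) ht ht'
      (zpow_mul_pow_mul_pow_eq_one hg hh rel hi hj)
  refine ⟨fun ⟨h3, h4⟩ => key 15 0 h1 ?_ ?_, fun ⟨h3, h4⟩ => key 25 5 h2 ?_ ?_⟩ <;> omega

section Relation

variable {S : Type*} [CommRing S] {Φ : S} {g h η : Sˣ}

lemma PhiThree.dvd_or_dvd (hΦ : PhiThree (g : S) h Φ) (hS : OrdersThree (g : S) h)
    (hη : 23 * (η : S) = -Φ) {r s t : ℤ} (rel : g ^ r * h ^ s * η ^ t = 1) :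
    3 ∣ r ∧ 3 ∣ s ∨ 3 ∣ r + t ∧ 3 ∣ s + 2 * t := by
  obtain ⟨h0, h1, h2, ind⟩ := hS
  have hη' : (η : S) = Φ := by linear_combination 8 * h0 * η - hη
  subst hη'
  refine dvd_or_dvd_of_zpow_mul_zpow_mul_zpow_eq_one ?_ ?_ ?_ ?_ rel
  · exact Units.ext (by simpa using h1)
  · exact Units.ext (by simpa using h2)
  · intro i j hij
    exact ind i j (by simpa using congrArg Units.val hij)
  · exact hΦ.imp (fun h => Units.ext (by simpa using h)) (fun h => Units.ext (by simpa using h))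

lemma PhiTwentyNine.not_dvd_and_not_dvd (hΦ : PhiTwentyNine (g : S) h Φ)
    (hS : OrdersTwentyNine (g : S) h) (hη : 23 * (η : S) = -Φ) {r s t : ℤ}
    (rel : g ^ r * h ^ s * η ^ t = 1) (hr : ¬ 2 ∣ r) (ht : ¬ 2 ∣ t) (ht' : ¬ 3 ∣ t) :
    ¬ (3 ∣ r ∧ 3 ∣ s) ∧ ¬ (3 ∣ r + t ∧ 3 ∣ s + 2 * t) := by
  obtain ⟨h0, h1, h2⟩ := hS
  have hη' : (η : S) = 5 * Φ := by linear_combination 4 * h0 * η - 5 * hη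
  rw [PhiTwentyNine, ← hη'] at hΦ
  exact HasEvenPart.not_dvd_and_not_dvd (Units.ext (by simpa using h1))
    (Units.ext (by simpa using h2)) hΦ.1 hΦ.2 rel hr ht ht'

/-- A multiplicative relation between three units, reduced modulo two primes. -/
theorem dvd_of_zpow_relation {S₁ S₂ : Type*} [CommRing S₁] [CommRing S₂] (f₁ : S →+* S₁)
    (f₂ : S →+* S₂) {G₁ H₁ Φ₁ : S₁} {G₂ H₂ Φ₂ : S₂} (o₁ : OrdersThree G₁ H₁)
    (o₂ : OrdersTwentyNine G₂ H₂) (p₁ : PhiThree G₁ H₁ Φ₁) (p₂ : PhiTwentyNine G₂ H₂ Φ₂)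
    (hg₁ : f₁ g = G₁) (hg₂ : f₂ g = G₂) (hh₁ : f₁ h = H₁) (hh₂ : f₂ h = H₂) (hΦ₁ : f₁ Φ = Φ₁)
    (hΦ₂ : f₂ Φ = Φ₂) (hη : 23 * (η : S) = -Φ) {r s t : ℤ}
    (hr : ¬ 2 ∣ r) (ht : ¬ 2 ∣ t) (rel : g ^ r * h ^ s * η ^ t = 1) : 3 ∣ r ∧ 3 ∣ s ∧ 3 ∣ t := by
  subst hg₁ hg₂ hh₁ hh₂ hΦ₁ hΦ₂
  have F₁ := congrArg (Units.map f₁.toMonoidHom) rel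
  have F₂ := congrArg (Units.map f₂.toMonoidHom) rel
  have E₁ := congrArg f₁ hη
  have E₂ := congrArg f₂ hη
  simp only [_root_.map_mul, map_zpow, _root_.map_one, map_neg, map_ofNat] at F₁ F₂ E₁ E₂
  have k₁ := PhiThree.dvd_or_dvd (g := Units.map f₁.toMonoidHom g)
    (h := Units.map f₁.toMonoidHom h) p₁ o₁ E₁ F₁
  have k₂ := PhiTwentyNine.not_dvd_and_not_dvd (g := Units.map f₂.toMonoidHom g)
    (h := Units.map f₂.toMonoidHom h) p₂ o₂ E₂ F₂ hr ht
  omega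

end Relation

set_option maxHeartbeats 4000000 in
/-- A multiplicative relation between two units and the unit attached to a point. -/
theorem IsPoint.dvd_of_zpow_relation {x y a b c : ℤ} (h : (three 2 : Shape ℤ).IsPoint x y a b c)
    {g₁ g₂ η : (SqrtRing (three 2 : Shape ℤ).δ)ˣ}
    (hg₁ : (g₁ : SqrtRing (three 2 : Shape ℤ).δ) = sixFst ℤ)
    (hg₂ : (g₂ : SqrtRing (three 2 : Shape ℤ).δ) = sixSnd ℤ)
    (hη : 23 * (η : SqrtRing (three 2 : Shape ℤ).δ) = -phiMulStar x a b c) {r s t : ℤ}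
    (hr : ¬ 2 ∣ r) (ht : ¬ 2 ∣ t)
    (rel : g₁ ^ r * g₂ ^ s * η ^ t = 1) : 3 ∣ r ∧ 3 ∣ s ∧ 3 ∣ t := by
  have hδ (p : ℕ) : CubicRing.map (Int.castRingHom (ZMod p)) (three 2 : Shape ℤ).δ =
      (three 2 : Shape (ZMod p)).δ := by
    ext <;> simp [CubicRing.map, three] <;> norm_num
  have hS (p : ℕ) : (three 2 : Shape ℤ).map (Int.castRingHom (ZMod p)) = three 2 := by
    rw [map_three, map_ofNat]
  have hp (p : ℕ) : (three 2 : Shape (ZMod p)).IsPoint x y a b c := hS p ▸ h.map _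
  have f₁ (p : ℕ) : SqrtRing.map (Int.castRingHom (ZMod p)) (hδ p) (sixFst ℤ) =
      sixFst (ZMod p) := by
    ext <;> simp [SqrtRing.map, CubicRing.map, sixFst]
  have f₂ (p : ℕ) : SqrtRing.map (Int.castRingHom (ZMod p)) (hδ p) (sixSnd ℤ) =
      sixSnd (ZMod p) := by
    ext <;> simp [SqrtRing.map, CubicRing.map, sixSnd]
  have f₃ (p : ℕ) : SqrtRing.map (Int.castRingHom (ZMod p)) (hδ p) (phiMulStar x a b c) =
      phiMulStar (x : ZMod p) a b c := by
    rw [phiMulStar, map_phi_mul_star _ (hS p)]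
    simp [phiMulStar]
  rw [← hg₁] at f₁
  rw [← hg₂] at f₂
  refine Shape.dvd_of_zpow_relation (Φ := phiMulStar x a b c) (η := η)
    (SqrtRing.map (Int.castRingHom (ZMod 3)) (hδ 3))
    (SqrtRing.map (Int.castRingHom (ZMod 29)) (hδ 29)) ordersThree ordersTwentyNine ?_ ?_ (f₁ 3)
    (f₁ 29) (f₂ 3) (f₂ 29) (f₃ 3) (f₃ 29) ?_ hr ht ?_
  · exact (hp 3).phiThree
  · exact (hp 29).phiTwentyNine
  · exact hη
  · exact rel

/-- A multiplicative relation between units congruent to `1` modulo `4`, to first order. -/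
lemma exists_of_zpow_relation {S : Type*} [CommRing S] {g₁ g₂ g₃ : Sˣ}
    {θ₁ θ₂ θ₃ : S} (h₁ : (g₁ : S) = 1 + 4 * θ₁)
    (h₂ : (g₂ : S) = 1 + 4 * θ₂) (h₃ : (g₃ : S) = 1 + 4 * θ₃) {r s t : ℤ}
    (rel : g₁ ^ r * g₂ ^ s * g₃ ^ t = 1) : ∃ w, 4 * (r * θ₁ + s * θ₂ + t * θ₃) = 4 * (2 * w) := by
  obtain ⟨w₁, hw₁⟩ := Units.exists_zpow_eq h₁ r
  obtain ⟨w₂, hw₂⟩ := Units.exists_zpow_eq h₂ s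
  obtain ⟨w₃, hw₃⟩ := Units.exists_zpow_eq h₃ t
  have := congrArg Units.val rel
  rw [Units.val_mul, Units.val_mul, hw₁, hw₂, hw₃, Units.val_one] at this
  obtain ⟨x, hx⟩ : ∃ x, x = r * θ₁ + 4 * θ₁ ^ 2 * w₁ := ⟨_, rfl⟩
  obtain ⟨y, hy⟩ : ∃ y, y = s * θ₂ + 4 * θ₂ ^ 2 * w₂ := ⟨_, rfl⟩
  obtain ⟨z, hz⟩ : ∃ z, z = t * θ₃ + 4 * θ₃ ^ 2 * w₃ := ⟨_, rfl⟩
  refine ⟨-(2 * (θ₁ ^ 2 * w₁ + θ₂ ^ 2 * w₂ + θ₃ ^ 2 * w₃) + 2 * (x * y + y * z + z * x) +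
    8 * (x * y * z)), ?_⟩
  rw [show (1 : S) + r * (4 * θ₁) + (4 * θ₁) ^ 2 * w₁ = 1 + 4 * x by rw [hx]; ring,
    show (1 : S) + s * (4 * θ₂) + (4 * θ₂) ^ 2 * w₂ = 1 + 4 * y by rw [hy]; ring,
    show (1 : S) + t * (4 * θ₃) + (4 * θ₃) ^ 2 * w₃ = 1 + 4 * z by rw [hz]; ring] at this
  linear_combination this - 4 * hx - 4 * hy - 4 * hz

/-- A multiplicative relation between units congruent to `1` modulo `4`, reduced modulo `2`. -/
lemma exists_im_of_zpow_relation {δ : CubicRing ℤ} {g₁ g₂ g₃ : (SqrtRing δ)ˣ}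
    {θ₁ θ₂ θ₃ : SqrtRing δ} (h₁ : (g₁ : SqrtRing δ) = 1 + 4 * θ₁)
    (h₂ : (g₂ : SqrtRing δ) = 1 + 4 * θ₂) (h₃ : (g₃ : SqrtRing δ) = 1 + 4 * θ₃) {r s t : ℤ}
    (rel : g₁ ^ r * g₂ ^ s * g₃ ^ t = 1) :
    ∃ w, (r : CubicRing ℤ) * θ₁.im + s * θ₂.im + t * θ₃.im = 2 * w := by
  obtain ⟨w, hw⟩ := exists_of_zpow_relation h₁ h₂ h₃ rel
  have := nsmul_right_injective (n := 4) (by norm_num)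
    (a₁ := (r : SqrtRing δ) * θ₁ + s * θ₂ + t * θ₃) (a₂ := 2 * w)
    (by simp only [nsmul_eq_mul]; push_cast; exact hw)
  refine ⟨w.im, ?_⟩
  simpa [two_mul] using congrArg QuadraticAlgebra.im this

end Shape

end CubicRing

namespace CubicRing

namespace Shape

lemma not_dvd_and_not_dvd_of_form_eq {r s t a b c : ℤ} {v w : CubicRing ℤ} (ha : Odd a)
    (hb : Even b) (hc : Even c) (h : ¬ (2 ∣ r ∧ 2 ∣ s ∧ 2 ∣ t))
    (hw : (r : CubicRing ℤ) * ⟨63, -139, 39⟩ + s * ⟨-13731, 10923, -2446⟩ +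
      t * (2 * v + (three 2 : Shape ℤ).form a (b - 1) c) = 2 * w) : ¬ 2 ∣ r ∧ ¬ 2 ∣ t := by
  have key (n : ℤ) : 2 ∣ n ↔ (n : ZMod 2) = 0 := (ZMod.intCast_zmod_eq_zero_iff_dvd n 2).symm
  have i0 := congrArg (fun w : CubicRing ℤ => (w.c0 : ZMod 2)) hw
  have i1 := congrArg (fun w : CubicRing ℤ => (w.c1 : ZMod 2)) hw
  have i2 := congrArg (fun w : CubicRing ℤ => (w.c2 : ZMod 2)) hw
  have two : (2 : ZMod 2) = 0 := rfl
  rw [← ZMod.intCast_eq_one_iff_odd] at ha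
  rw [← ZMod.intCast_eq_zero_iff_even] at hb hc
  simp only [key] at h ⊢
  simp [two, form, three, scalar, ha, hb, hc] at i0 i1 i2
  revert i0 i1 i2 h
  generalize (r : ZMod 2) = r
  generalize (s : ZMod 2) = s
  generalize (t : ZMod 2) = t
  revert r s t
  decide +kernel

set_option maxHeartbeats 4000000 in
theorem IsPoint.not_odd_of_even_of_even {x y a b c : ℤ}
    (h : (three 2 : Shape ℤ).IsPoint x y a b c)
    (hc : (three 2 : Shape (ZMod 23)).Compat ⟨5, 0, 21⟩ x a b c)
    (ha : Odd a) (hb : Even b) (hc' : Even c) : False := by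
  have h₀ : (three 2 : Shape ℤ).IsPoint (-1) 0 0 1 0 := by constructor <;> decide
  have hS : (three 2 : Shape ℤ).map (Int.castRingHom (ZMod 23)) = three 2 := by
    rw [map_three, map_ofNat]
  have e1 : -1 + 2 ^ 0 * (x + 1) = x := by ring
  have e2 : 0 + 2 ^ 0 * a = a := by ring
  have e3 : 1 + 2 ^ 0 * (b - 1) = b := by ring
  have e4 : 0 + 2 ^ 0 * c = c := by ring
  obtain ⟨η, θ, hη, hφ, hθ, v, hv⟩ := exists_unit (S := three 2) (τ := ⟨5, 0, 21⟩) (k := 0)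
    (x := -1) (a := 0) (b := 1) (c := 0) (u := x + 1) (d := a) (e := b - 1) (f := c)
    (by decide +kernel) (norm_phi_three h₀) (by rw [e1, e2, e3, e4]; exact norm_phi_three h)
    (by rw [hS]; decide +kernel) (by rw [hS, e1, e2, e3, e4]; exact hc)
  rw [e1, e2, e3, e4] at hφ
  rw [pow_zero, mul_one] at hθ
  obtain ⟨g₁, hg₁, hn₁⟩ : ∃ g : (SqrtRing (three 2 : Shape ℤ).δ)ˣ,
      (g : SqrtRing (three 2 : Shape ℤ).δ) = sixFst ℤ ∧
      QuadraticAlgebra.norm (g : SqrtRing (three 2 : Shape ℤ).δ) = 1 :=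
    ⟨unitOfNorm _ norm_six_fst, rfl, norm_six_fst⟩
  obtain ⟨g₂, hg₂, hn₂⟩ : ∃ g : (SqrtRing (three 2 : Shape ℤ).δ)ˣ,
      (g : SqrtRing (three 2 : Shape ℤ).δ) = sixSnd ℤ ∧
      QuadraticAlgebra.norm (g : SqrtRing (three 2 : Shape ℤ).δ) = 1 :=
    ⟨unitOfNorm _ norm_six_snd, rfl, norm_six_snd⟩
  have hθ₁ : (g₁ : SqrtRing (three 2 : Shape ℤ).δ) =
      1 + 4 * ⟨⟨108, -240, 72⟩, ⟨63, -139, 39⟩⟩ := by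
    rw [hg₁]; decide +kernel
  have hθ₂ : (g₂ : SqrtRing (three 2 : Shape ℤ).δ) =
      1 + 4 * ⟨⟨46008, -36600, 8196⟩, ⟨-13731, 10923, -2446⟩⟩ := by
    rw [hg₂]; decide +kernel
  obtain ⟨p, h2, h3, rel⟩ := SqrtRing.exists_primitive_zpow_relation (δ := (three 2 : Shape ℤ).δ)
    (δ' := ⟨0, 1, 0⟩) (m := 6) (by norm_num) (by decide +kernel) (u := ![g₁, g₂, η])
    (θ := ![⟨⟨108, -240, 72⟩, ⟨63, -139, 39⟩⟩,
      ⟨⟨46008, -36600, 8196⟩, ⟨-13731, 10923, -2446⟩⟩, θ])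
    (by intro i; fin_cases i; exacts [hn₁, hn₂, hη])
    (by intro i; fin_cases i; exacts [hθ₁, hθ₂, hθ])
  rw [Fin.prod_univ_three] at rel
  simp only [Matrix.cons_val] at rel
  rw [Fin.forall_fin_succ, Fin.forall_fin_two] at h2 h3
  obtain ⟨w, hw⟩ := exists_im_of_zpow_relation hθ₁ hθ₂ hθ rel
  rw [sub_eq_iff_eq_add.1 hv, QuadraticAlgebra.im_add, two_mul, QuadraticAlgebra.im_add,
    ← two_mul] at hw
  obtain ⟨hr, ht⟩ := not_dvd_and_not_dvd_of_form_eq ha hb hc' h2 hw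
  exact h3 (h.dvd_of_zpow_relation hg₁ hg₂ hφ hr ht rel)

theorem IsPoint.lt_three_of_six {x y a b c : ℤ} (h : (three 2 : Shape ℤ).IsPoint x y a b c) :
    y < 3 := by
  by_contra! hy
  obtain ⟨a, b, c, h, hc⟩ := h.exists_compat (S' := three 2) (by rw [map_three, map_ofNat])
    fun _ _ _ _ _ => compat_or_compat_neg_six
  obtain ⟨x, y, c, rfl, rfl, rfl, hh⟩ := h.exists_isHalfPoint rfl
    (.inr (by rw [map_three, map_ofNat]))
  have hpar := hh.parity (by decide) (by decide)
  simp only [Int.even_iff] at hpar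
  rcases hpar with hp | hp | hp
  · exact h.not_odd_of_even_of_even hc (Int.odd_iff.2 (by omega)) (Int.even_iff.2 (by omega))
      (Int.even_iff.2 (by omega))
  · have h₀ : (three 2 : Shape ℤ).IsPoint (-1) 0 0 1 0 := by constructor <;> decide
    have hh₀ : IsHalfPoint (three 2 : Shape ℤ).m (three 2 : Shape ℤ).n (-1) 0 0 1 0 := by
      constructor <;> decide
    obtain ⟨k, u, d, e, f, rfl, rfl, rfl, rfl, h12, h13, h23, hne⟩ :=
      hh₀.exists_even_of_close (by decide) hh (by omega) (by omega) (by omega) (by omega)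
        (by omega) (by omega)
    have hx : 2 * (-1 + 2 ^ k * u) + 1 = -1 + 2 ^ k * (2 * u) := by ring
    have hz : 2 * (0 + 2 ^ k * f) = 0 + 2 ^ k * (2 * f) := by ring
    rw [hx, hz] at h hc
    refine not_odd_of_compat_six h₀ h (by decide +kernel) hc ?_
    simp only [Int.even_iff, Int.odd_iff] at *
    omega
  · have h₀ : (three 2 : Shape ℤ).IsPoint (-1) 0 0 1 0 := by constructor <;> decide
    obtain ⟨u, hu⟩ : ∃ u, 2 * x + 1 = -1 + 2 ^ 0 * u := ⟨2 * x + 1 - (-1), by ring⟩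
    obtain ⟨d, rfl⟩ : ∃ d, a = 0 + 2 ^ 0 * d := ⟨a - 0, by ring⟩
    obtain ⟨e, rfl⟩ : ∃ e, b = 1 + 2 ^ 0 * e := ⟨b - 1, by ring⟩
    obtain ⟨f, hf⟩ : ∃ f, 2 * c = 0 + 2 ^ 0 * f := ⟨2 * c - 0, by ring⟩
    rw [hu, hf] at h hc
    refine not_odd_of_compat_six h₀ h (by decide +kernel) hc ?_
    rw [Int.odd_iff]
    omega

end Shape

end CubicRing

namespace CubicRing.Shape

lemma dvd_six_of_squarefree {α : ℕ} (h : Squarefree α)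
    (hp : ∀ p : ℕ, p.Prime → p ∣ α → p ∣ 6) : α ∣ 6 := by
  rw [← Nat.prod_primeFactors_of_squarefree h]
  refine Finset.prod_primes_dvd _ (fun p hp => ?_) fun p hp' => ?_
  · exact (Nat.prime_of_mem_primeFactors hp).prime
  · exact hp p (Nat.prime_of_mem_primeFactors hp') (Nat.dvd_of_mem_primeFactors hp')

/-- Descent to one of four coverings. -/
theorem exists_covering {x y : ℤ} (h : x ^ 3 - x = y * (x + y) * (x + y - 1)) (hx : 0 < x)
    (hs : 0 < x - y + 1) : ∃ α a b c : ℤ, (α = 1 ∨ α = 2 ∨ α = 3 ∨ α = 6) ∧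
      α * a ^ 2 = x * (x - y + 1) ∧ a * b = x * y ∧ α * (a * c) = y * (x - y + 1) ∧
      3 * b ^ 2 = α * (x ^ 2 - x + y ^ 2) ∧ b * c = y ^ 2 ∧
      α * c ^ 2 = 1 - y - x ^ 2 + x * y + 3 * y ^ 2 := by
  obtain ⟨α, a, hα, ha⟩ : ∃ (α : ℕ) (a : ℤ), Squarefree α ∧ α * a ^ 2 = x * (x - y + 1) := by
    obtain ⟨α, a, h1, h2⟩ := Nat.sq_mul_squarefree (x * (x - y + 1)).toNat
    refine ⟨α, a, h2, ?_⟩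
    rw [← Int.toNat_of_nonneg (mul_pos hx hs).le, ← h1]
    push_cast
    ring
  have hα' : Squarefree (α : ℤ) := Int.squarefree_natCast.2 hα
  have hxs := mul_pos hx hs
  have ha0 : a ≠ 0 := by
    rintro rfl
    rw [← ha] at hxs
    simp at hxs
  obtain ⟨b, hb⟩ : a ∣ x * y := by
    have h1 : (3 * (x * y)) ^ 2 = a ^ 2 * (3 * (α * (x ^ 2 - x + y ^ 2))) := by
      linear_combination (-3 * (x ^ 2 - x + y ^ 2)) * ha - 3 * x * h
    obtain ⟨m, hm⟩ := (Int.pow_dvd_pow_iff two_ne_zero).1 (Dvd.intro _ h1.symm)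
    rw [hm, mul_pow] at h1
    have h2 := mul_left_cancel₀ (pow_ne_zero 2 ha0) h1
    obtain ⟨b, rfl⟩ := Int.prime_three.dvd_of_dvd_pow (Dvd.intro _ h2.symm)
    exact ⟨b, by linarith⟩
  have hb' : 3 * b ^ 2 = α * (x ^ 2 - x + y ^ 2) := by
    refine mul_left_cancel₀ (pow_ne_zero 2 ha0) ?_
    linear_combination (-3 * (x * y + a * b)) * hb - (x ^ 2 - x + y ^ 2) * ha - x * h
  have hF : (y * (x - y + 1)) ^ 2 = a ^ 2 * (α * (1 - y - x ^ 2 + x * y + 3 * y ^ 2)) := by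
    linear_combination (-(1 - y - x ^ 2 + x * y + 3 * y ^ 2)) * ha + (x - y + 1) * h
  obtain ⟨t, ht⟩ := (Int.pow_dvd_pow_iff two_ne_zero).1 (Dvd.intro _ hF.symm)
  rw [ht, mul_pow] at hF
  have ht' := mul_left_cancel₀ (pow_ne_zero 2 ha0) hF
  obtain ⟨c, rfl⟩ := (hα'.dvd_pow_iff_dvd two_ne_zero).1 (Dvd.intro _ ht'.symm)
  have hα0 : (α : ℤ) ≠ 0 := hα'.ne_zero
  have hc : α * c ^ 2 = 1 - y - x ^ 2 + x * y + 3 * y ^ 2 :=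
    mul_left_cancel₀ hα0 (by linear_combination ht')
  have hbc : b * c = y ^ 2 := by
    refine mul_left_cancel₀ hxs.ne' ?_
    linear_combination (-(b * c)) * ha + (-(α * a * c)) * hb - x * y * ht
  have h3D : (α : ℤ) ∣ 3 * (x ^ 2 - x + y ^ 2) := by
    obtain ⟨e, he⟩ := (hα'.dvd_pow_iff_dvd two_ne_zero (y := 3 * b)).1
      ⟨3 * (x ^ 2 - x + y ^ 2), by linear_combination 3 * hb'⟩
    exact ⟨e ^ 2, mul_left_cancel₀ hα0 (by linear_combination (3 * b + α * e) * he - 3 * hb')⟩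
  have h6 : α ∣ 6 := by
    refine dvd_six_of_squarefree hα fun p hp hpα => ?_
    have hp' := Nat.prime_iff_prime_int.1 hp
    have hpα' : (p : ℤ) ∣ α := by exact_mod_cast hpα
    have h1 := hpα'.trans (Dvd.intro _ ha)
    have h2 := hpα'.trans (Dvd.intro _ hc)
    suffices (p : ℤ) ∣ 6 by exact_mod_cast this
    rcases hp'.dvd_mul.1 (hpα'.trans h3D) with h3 | h3
    · exact h3.trans (by norm_num)
    rcases hp'.dvd_mul.1 h1 with h4 | h4
    · have hy : (p : ℤ) ∣ y := hp'.dvd_of_dvd_pow (n := 2)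
        ((dvd_add_right (h4.mul_right (x - 1))).1 (by convert h3 using 1; ring))
      have : (p : ℤ) ∣ 1 := (dvd_add_right (dvd_add (hy.mul_right (3 * y - 1)) (h4.mul_right (y - x)))).1
        (by convert h2 using 1; ring)
      exact this.trans (one_dvd _)
    · have hy : (p : ℤ) ∣ 3 * y ^ 2 := (dvd_add_right (h4.mul_right (1 - x))).1
        (by convert h2 using 1; ring)
      rcases hp'.dvd_mul.1 hy with hy | hy
      · exact hy.trans (by norm_num)
      have hy := hp'.dvd_of_dvd_pow hy
      have : (p : ℤ) ∣ 2 := (dvd_add_right (dvd_add (h4.mul_right (x + y - 2)) (hy.mul_right (2 * y - 3)))).1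
        (by convert h3 using 1; ring)
      exact this.trans (by norm_num)
  refine ⟨α, a, b, c, ?_, ha, hb.symm, by linear_combination -ht, hb', hbc, hc⟩
  have := Nat.le_of_dvd (by norm_num) h6
  interval_cases α <;> simp_all

/-- Integral points of the cubic curve in the relevant region. -/
theorem lt_three_of_curve {x y : ℤ} (h : x ^ 3 - x = y * (x + y) * (x + y - 1)) (hx : 0 < x)
    (hs : 0 < x - y + 1) : y < 3 := by
  obtain ⟨α, a, b, c, hα, h1, h2, h3, h4, h5, h6⟩ := exists_covering h hx hs
  rcases hα with rfl | rfl | rfl | rfl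
  · refine IsPoint.lt_three_of_one (x := x) (a := a) (b := b) (c := c) ?_
    refine ⟨h, ?_, ?_, ?_, ?_, ?_, ?_⟩ <;> dsimp only [one] <;> linarith
  · obtain ⟨b, rfl⟩ := Int.prime_two.dvd_of_dvd_pow
      ((Int.prime_two.dvd_mul.1 (Dvd.intro _ h4.symm)).resolve_left (by norm_num))
    refine IsPoint.lt_three_of_two (x := x) (a := a) (b := b) (c := c) ?_
    refine ⟨h, ?_, ?_, ?_, ?_, ?_, ?_⟩ <;> dsimp only [one] <;> linarith
  · refine IsPoint.lt_three_of_three (x := x) (a := a) (b := b) (c := c) ?_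
    refine ⟨h, ?_, ?_, ?_, ?_, ?_, ?_⟩ <;> dsimp only [three] <;> linarith
  · obtain ⟨b, rfl⟩ := Int.prime_two.dvd_of_dvd_pow
      (Dvd.intro (x ^ 2 - x + y ^ 2) (by linarith : _ = b ^ 2))
    refine IsPoint.lt_three_of_six (x := x) (a := a) (b := b) (c := c) ?_
    refine ⟨h, ?_, ?_, ?_, ?_, ?_, ?_⟩ <;> dsimp only [three] <;> linarith

end CubicRing.Shape

/-- The collision equation as a cubic curve. -/
lemma mul_eq_of_choose_eq {n k : ℕ} (h : (n + k + 3).choose k = (n + k + 1).choose (k + 1)) :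
    (n + 3) * (n + 2) * (n + 1) = (n + k + 3) * (n + k + 2) * (k + 1) := by
  have h1 := Nat.choose_mul_factorial_mul_factorial (show k ≤ n + k + 3 by omega)
  have h2 := Nat.choose_mul_factorial_mul_factorial (show k + 1 ≤ n + k + 1 by omega)
  rw [show n + k + 3 - k = n + 3 by omega, h] at h1
  rw [show n + k + 1 - (k + 1) = n by omega] at h2
  simp only [Nat.factorial_succ] at h1 h2
  have hpos : 0 < (n + k + 1).choose (k + 1) * k.factorial * n.factorial := by
    have := Nat.choose_pos (show k + 1 ≤ n + k + 1 by omega)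
    positivity
  refine Nat.eq_of_mul_eq_mul_left hpos ?_
  linear_combination h1 - (n + k + 3) * (n + k + 2) * h2

theorem no_collision_n_sub_two_k_add_one (n k : ℕ) (hk2 : 2 ≤ k) (hkn : k ≤ n / 2)
    (hl2 : 2 ≤ k + 1) (hlm : k + 1 ≤ (n - 2) / 2) :
    Nat.choose n k ≠ Nat.choose (n - 2) (k + 1) := by
  intro h
  obtain ⟨m, rfl⟩ : ∃ m, n = m + k + 3 := ⟨n - k - 3, by omega⟩
  have := mul_eq_of_choose_eq h
  zify at this
  have h3 := CubicRing.Shape.lt_three_of_curve (x := m + 2) (y := k + 1)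
    (by linear_combination this) (by omega) (by omega)
  omega
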